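/- (Extrapolation for 1 ≤ p < q, Theorem 1.1.) Let 1<q<2 and 1≤p<q. Suppose there is a constant β such that for all n, N and all x_1,…,x_N ∈ M_n(ℂ) one has |||x|||_q ≤ β (E_ε ‖∑_k ε_k x_k‖_q^q)^{1/q}. Then there is a constant β′, depending only on p, q and β, such that for all n, N and all x_1,…,x_N ∈ M_n(ℂ) one has |||x|||_p ≤ β′ (E_ε ‖∑_k ε_k x_k‖_p^p)^{1/p}. -/

import Mathlib

open scoped BigOperators
open Matrix MeasureTheory
open scoped ComplexOrder

/-- `A^β` for a Hermitian (in practice positive semidefinite) matrix `A`, via the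
spectral functional calculus (with the conventions of `Real.rpow` on eigenvalues,
in particular `0 ^ β = 0` for `β ≠ 0`), extended by `0` to non-Hermitian matrices. -/
noncomputable def posPow {ι : Type*} [Fintype ι] [DecidableEq ι]
    (A : Matrix ι ι ℂ) (β : ℝ) : Matrix ι ι ℂ :=
  if hA : A.IsHermitian then hA.cfc (fun t => t ^ β) else 0

/-- Schatten `p`-(quasi)norm of a complex matrix: `(Tr((A*A)^(p/2)))^(1/p)`. -/
noncomputable def schattenNorm {ι : Type*} [Fintype ι] [DecidableEq ι]
    (p : ℝ) (A : Matrix ι ι ℂ) : ℝ :=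
  ((posPow (Aᴴ * A) (p / 2)).trace.re) ^ (1 / p)

/-- Operator norm of a matrix, acting on the Euclidean space. -/
noncomputable def opNorm {ι : Type*} [Fintype ι] [DecidableEq ι]
    (A : Matrix ι ι ℂ) : ℝ :=
  ‖Matrix.toEuclideanCLM (𝕜 := ℂ) A‖

/-- The quantity `|||x|||_p` for `0 < p ≤ 2`: the infimum of
`‖(∑ aₖ*aₖ)^(1/2)‖_p + ‖(∑ bₖbₖ*)^(1/2)‖_p` over decompositions `xₖ = aₖ + bₖ`. -/
noncomputable def tripleNorm {n N : ℕ} (p : ℝ)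
    (x : Fin N → Matrix (Fin n) (Fin n) ℂ) : ℝ :=
  sInf { r : ℝ | ∃ a b : Fin N → Matrix (Fin n) (Fin n) ℂ,
    (∀ k, x k = a k + b k) ∧
    r = schattenNorm p (posPow (∑ k, (a k)ᴴ * a k) (1/2))
        + schattenNorm p (posPow (∑ k, b k * (b k)ᴴ) (1/2)) }

/-- `E_ε ‖∑ ε_k x_k‖_p ^ p`, the average over a uniformly random choice of signs. -/
noncomputable def radAvg {n N : ℕ} (p : ℝ)
    (x : Fin N → Matrix (Fin n) (Fin n) ℂ) : ℝ :=
  (1 / 2 ^ N) * ∑ ε : Fin N → Bool,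
    (schattenNorm p (∑ k, (if ε k then (1 : ℂ) else -1) • x k)) ^ p

theorem conjTranspose_mul_apply_self {ι : Type*} (M : Matrix ι ι ℂ) (i j : ι) :
    M i j * Mᴴ j i = ((‖M i j‖ ^ 2 : ℝ) : ℂ) := by
  rw [conjTranspose_apply, Complex.star_def, Complex.mul_conj, Complex.normSq_eq_norm_sq]

section SpectralForm

variable {ι : Type*} [Fintype ι] [DecidableEq ι]

/-- The matrix with spectral data `(U, d)`. -/
noncomputable def spectralForm (U : Matrix ι ι ℂ) (d : ι → ℝ) : Matrix ι ι ℂ :=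
  U * diagonal (fun i => (d i : ℂ)) * Uᴴ

/-- Functional calculus of a Hermitian matrix, extended by `0` to all matrices. -/
noncomputable def hermFun (A : Matrix ι ι ℂ) (f : ℝ → ℝ) : Matrix ι ι ℂ :=
  if hA : A.IsHermitian then hA.cfc f else 0

theorem posPow_eq_hermFun (A : Matrix ι ι ℂ) (β : ℝ) :
    posPow A β = hermFun A (fun t => t ^ β) := rfl

theorem isHermitian_spectralForm (U : Matrix ι ι ℂ) (d : ι → ℝ) :
    (spectralForm U d).IsHermitian := by
  unfold spectralForm IsHermitian
  simp only [conjTranspose_mul, conjTranspose_conjTranspose, diagonal_conjTranspose,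
    Matrix.mul_assoc]
  congr 3
  ext i
  simp

theorem exists_spectralForm {A : Matrix ι ι ℂ} (hA : A.IsHermitian) :
    ∃ (U : Matrix ι ι ℂ) (d : ι → ℝ), Uᴴ * U = 1 ∧ A = spectralForm U d ∧
      ∀ f, hermFun A f = spectralForm U (fun i => f (d i)) := by
  refine ⟨hA.eigenvectorUnitary, hA.eigenvalues, ?_, ?_, fun f => ?_⟩
  · exact Unitary.coe_star_mul_self hA.eigenvectorUnitary
  · conv_lhs => rw [hA.spectral_theorem, Unitary.conjStarAlgAut_apply]
    rfl
  · rw [hermFun, dif_pos hA, IsHermitian.cfc, Unitary.conjStarAlgAut_apply]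
    rfl

theorem spectralForm_congr {U V : Matrix ι ι ℂ} (hU : Uᴴ * U = 1) (hV : Vᴴ * V = 1)
    {d e : ι → ℝ} (h : spectralForm U d = spectralForm V e) (f : ℝ → ℝ) :
    spectralForm U (fun i => f (d i)) = spectralForm V (fun i => f (e i)) := by
  have hU' : U * Uᴴ = 1 := mul_eq_one_comm.mp hU
  have hV' : V * Vᴴ = 1 := mul_eq_one_comm.mp hV
  have key : ∀ a b : ι → ℝ, spectralForm U a = spectralForm V b ↔
      diagonal (fun i => (a i : ℂ)) * (Uᴴ * V) = (Uᴴ * V) * diagonal (fun i => (b i : ℂ)) := by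
    intro a b
    unfold spectralForm
    constructor
    · intro h
      have := congrArg (fun M => Uᴴ * M * V) h
      simpa only [← Matrix.mul_assoc, hU, Matrix.one_mul, Matrix.mul_assoc _ Vᴴ V, hV,
        Matrix.mul_one] using this
    · intro h
      have := congrArg (fun M => U * M * Vᴴ) h
      simp only [← Matrix.mul_assoc, hU', Matrix.one_mul] at this
      simpa only [Matrix.mul_assoc, hV', Matrix.mul_one] using this
  rw [key] at h ⊢
  ext i j
  have hij := congrFun (congrFun h i) j
  rw [diagonal_mul, mul_diagonal] at hij ⊢
  by_cases ho : (Uᴴ * V) i j = 0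
  · simp [ho]
  · have : (d i : ℂ) = e j := by
      apply mul_right_cancel₀ ho
      rw [hij, mul_comm]
    rw [Complex.ofReal_inj.mp this, mul_comm]

theorem hermFun_spectralForm {U : Matrix ι ι ℂ} (hU : Uᴴ * U = 1) (d : ι → ℝ) (f : ℝ → ℝ) :
    hermFun (spectralForm U d) f = spectralForm U (fun i => f (d i)) := by
  obtain ⟨V, e, hV, h, hf⟩ := exists_spectralForm (isHermitian_spectralForm U d)
  rw [hf, spectralForm_congr hU hV h f]

theorem spectralForm_mul {U : Matrix ι ι ℂ} (hU : Uᴴ * U = 1) (a b : ι → ℝ) :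
    spectralForm U a * spectralForm U b = spectralForm U (fun i => a i * b i) := by
  unfold spectralForm
  rw [show U * diagonal (fun i => (a i : ℂ)) * Uᴴ * (U * diagonal (fun i => (b i : ℂ)) * Uᴴ)
    = U * diagonal (fun i => (a i : ℂ)) * (Uᴴ * U) * diagonal (fun i => (b i : ℂ)) * Uᴴ by
      simp only [Matrix.mul_assoc], hU, Matrix.mul_one, Matrix.mul_assoc U, diagonal_mul_diagonal]
  simp

theorem spectralForm_add (U : Matrix ι ι ℂ) (a b : ι → ℝ) :
    spectralForm U a + spectralForm U b = spectralForm U (fun i => a i + b i) := by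
  unfold spectralForm
  rw [← Matrix.add_mul, ← Matrix.mul_add, diagonal_add]
  simp

theorem spectralForm_one {U : Matrix ι ι ℂ} (hU : Uᴴ * U = 1) :
    spectralForm U (fun _ => 1) = 1 := by
  simp [spectralForm, mul_eq_one_comm.mp hU]

theorem trace_spectralForm {U : Matrix ι ι ℂ} (hU : Uᴴ * U = 1) (d : ι → ℝ) :
    (spectralForm U d).trace = ((∑ i, d i : ℝ) : ℂ) := by
  unfold spectralForm
  rw [trace_mul_comm, ← Matrix.mul_assoc, hU, Matrix.one_mul, trace_diagonal]
  push_cast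
  rfl

theorem sum_normSq_row {O : Matrix ι ι ℂ} (hO : O * Oᴴ = 1) (i : ι) :
    ∑ j, ‖O i j‖ ^ 2 = 1 := by
  have h := congrFun (congrFun hO i) i
  rw [mul_apply, one_apply_eq] at h
  simp only [conjTranspose_mul_apply_self] at h
  exact_mod_cast h

theorem sum_normSq_col {O : Matrix ι ι ℂ} (hO : Oᴴ * O = 1) (j : ι) :
    ∑ i, ‖O i j‖ ^ 2 = 1 := by
  have := sum_normSq_row (O := Oᴴ) (by simpa using hO) j
  simpa [conjTranspose_apply] using this

theorem unitary_conj_mul {U V : Matrix ι ι ℂ} (hU : Uᴴ * U = 1) (hV : Vᴴ * V = 1) :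
    (Uᴴ * V)ᴴ * (Uᴴ * V) = 1 ∧ (Uᴴ * V) * (Uᴴ * V)ᴴ = 1 := by
  have h : (Uᴴ * V)ᴴ * (Uᴴ * V) = 1 := by
    rw [conjTranspose_mul, conjTranspose_conjTranspose,
      show Vᴴ * U * (Uᴴ * V) = Vᴴ * (U * Uᴴ) * V by simp only [Matrix.mul_assoc],
      mul_eq_one_comm.mp hU, Matrix.mul_one, hV]
  exact ⟨h, mul_eq_one_comm.mp h⟩

theorem conj_spectralForm_apply (U V : Matrix ι ι ℂ) (m : ι → ℝ) (i : ι) :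
    (Uᴴ * spectralForm V m * U) i i = ((∑ j, ‖(Uᴴ * V) i j‖ ^ 2 * m j : ℝ) : ℂ) := by
  rw [show Uᴴ * spectralForm V m * U = ((Uᴴ * V) * diagonal (fun i => (m i : ℂ))) * (Uᴴ * V)ᴴ by
    simp only [spectralForm, conjTranspose_mul, conjTranspose_conjTranspose, Matrix.mul_assoc],
    mul_apply]
  push_cast
  refine Finset.sum_congr rfl fun j _ => ?_
  have := conjTranspose_mul_apply_self (Uᴴ * V) i j
  push_cast at this
  rw [mul_diagonal, ← this]
  ring

/-- A spectral form is recovered from the diagonal of its conjugate. -/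
theorem conj_spectralForm_self_apply {U : Matrix ι ι ℂ} (hU : Uᴴ * U = 1) (d : ι → ℝ) (i : ι) :
    (Uᴴ * spectralForm U d * U) i i = d i := by
  rw [conj_spectralForm_apply, hU, Finset.sum_eq_single i]
  · simp
  · intro j _ hj
    simp [one_apply_ne hj.symm]
  · simp

/-- Peierls' inequality for a convex power, before summation. -/
theorem rpow_conj_spectralForm_le {U V : Matrix ι ι ℂ} (hU : Uᴴ * U = 1) (hV : Vᴴ * V = 1)
    {m : ι → ℝ} (hm : ∀ j, 0 ≤ m j) {s : ℝ} (hs : 1 ≤ s) (i : ι) :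
    ((Uᴴ * spectralForm V m * U) i i).re ^ s ≤
      ((Uᴴ * spectralForm V (fun j => m j ^ s) * U) i i).re := by
  simp only [conj_spectralForm_apply, Complex.ofReal_re]
  have := (convexOn_rpow hs).map_sum_le (t := Finset.univ) (w := fun j => ‖(Uᴴ * V) i j‖ ^ 2)
    (p := m) (fun j _ => by positivity) (sum_normSq_row (unitary_conj_mul hU hV).2 i)
    (fun j _ => hm j)
  simpa using this

/-- Peierls' inequality for a concave power. -/
theorem sum_rpow_le_sum_conj {U V : Matrix ι ι ℂ} (hU : Uᴴ * U = 1) (hV : Vᴴ * V = 1)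
    {m : ι → ℝ} (hm : ∀ j, 0 ≤ m j) {θ : ℝ} (h0 : 0 ≤ θ) (h1 : θ ≤ 1) :
    ∑ j, m j ^ θ ≤ ∑ i, ((Uᴴ * spectralForm V m * U) i i).re ^ θ := by
  have hO := unitary_conj_mul hU hV
  calc ∑ j, m j ^ θ = ∑ j, (∑ i, ‖(Uᴴ * V) i j‖ ^ 2) * m j ^ θ := by
        simp [sum_normSq_col hO.1]
    _ = ∑ i, ∑ j, ‖(Uᴴ * V) i j‖ ^ 2 * m j ^ θ := by
        rw [Finset.sum_comm]
        simp [Finset.sum_mul]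
    _ ≤ _ := by
        refine Finset.sum_le_sum fun i _ => ?_
        rw [conj_spectralForm_apply, Complex.ofReal_re]
        have := (Real.concaveOn_rpow h0 h1).le_map_sum (t := Finset.univ)
          (w := fun j => ‖(Uᴴ * V) i j‖ ^ 2)
          (p := m) (fun j _ => by positivity) (sum_normSq_row hO.2 i) (fun j _ => hm j)
        simpa using this

end SpectralForm

theorem diag_conj_nonneg {ι : Type*} [Fintype ι] {D : Matrix ι ι ℂ} (hD : D.PosSemidef) (U : Matrix ι ι ℂ) (i : ι) :
    0 ≤ ((Uᴴ * D * U) i i).re :=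
  (Complex.nonneg_iff.mp ((hD.conjTranspose_mul_mul_same U).diag_nonneg (i := i))).1

section Holder

variable {ι : Type*} [Fintype ι] [DecidableEq ι]

theorem exists_spectralForm_nonneg {A : Matrix ι ι ℂ} (hA : A.PosSemidef) :
    ∃ (U : Matrix ι ι ℂ) (d : ι → ℝ), Uᴴ * U = 1 ∧ A = spectralForm U d ∧ ∀ i, 0 ≤ d i := by
  obtain ⟨U, d, hU, h, -⟩ := exists_spectralForm hA.1
  refine ⟨U, d, hU, h, fun i => ?_⟩
  have := (hA.conjTranspose_mul_mul_same U).diag_nonneg (i := i)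
  rw [h, conj_spectralForm_self_apply hU] at this
  exact_mod_cast this

theorem posPow_spectralForm {U : Matrix ι ι ℂ} (hU : Uᴴ * U = 1) (d : ι → ℝ) (β : ℝ) :
    posPow (spectralForm U d) β = spectralForm U (fun i => d i ^ β) := by
  rw [posPow_eq_hermFun, hermFun_spectralForm hU]

theorem trace_posPow_nonneg {A : Matrix ι ι ℂ} (hA : A.PosSemidef) (β : ℝ) :
    0 ≤ (posPow A β).trace.re := by
  obtain ⟨U, d, hU, rfl, hd⟩ := exists_spectralForm_nonneg hA
  rw [posPow_spectralForm hU, trace_spectralForm hU, Complex.ofReal_re]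
  exact Finset.sum_nonneg fun i _ => Real.rpow_nonneg (hd i) _

theorem schattenNorm_nonneg (p : ℝ) (A : Matrix ι ι ℂ) : 0 ≤ schattenNorm p A :=
  Real.rpow_nonneg (trace_posPow_nonneg (posSemidef_conjTranspose_mul_self A) _) _

theorem schattenNorm_rpow {p : ℝ} (hp : p ≠ 0) (A : Matrix ι ι ℂ) :
    schattenNorm p A ^ p = (posPow (Aᴴ * A) (p / 2)).trace.re := by
  rw [schattenNorm, ← Real.rpow_mul (trace_posPow_nonneg (posSemidef_conjTranspose_mul_self A) _),
    one_div_mul_cancel hp, Real.rpow_one]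

theorem schattenNorm_sqrt {C : Matrix ι ι ℂ} (hC : C.PosSemidef) (p : ℝ) :
    schattenNorm p (posPow C (1 / 2)) = (posPow C (p / 2)).trace.re ^ (1 / p) := by
  obtain ⟨U, d, hU, rfl, hd⟩ := exists_spectralForm_nonneg hC
  rw [schattenNorm, posPow_spectralForm hU, (isHermitian_spectralForm U _).eq, spectralForm_mul hU]
  congr 5
  ext i
  rw [← Real.sqrt_eq_rpow, Real.mul_self_sqrt (hd i)]

theorem trace_spectralForm_mul_re (U D : Matrix ι ι ℂ) (d : ι → ℝ) :
    (spectralForm U d * D).trace.re = ∑ i, d i * ((Uᴴ * D * U) i i).re := by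
  have : (spectralForm U d * D).trace =
      (diagonal (fun i => (d i : ℂ)) * (Uᴴ * D * U)).trace := by
    rw [spectralForm, Matrix.mul_assoc, Matrix.mul_assoc, trace_mul_comm]
    simp only [Matrix.mul_assoc]
  rw [this, trace, Complex.re_sum]
  refine Finset.sum_congr rfl fun i _ => ?_
  rw [diag_apply, diagonal_mul, Complex.re_ofReal_mul]

theorem trace_mul_nonneg {A B : Matrix ι ι ℂ} (hA : A.PosSemidef) (hB : B.PosSemidef) :
    0 ≤ (A * B).trace.re := by
  obtain ⟨U, d, hU, rfl, hd⟩ := exists_spectralForm_nonneg hA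
  rw [trace_spectralForm_mul_re]
  exact Finset.sum_nonneg fun i _ => mul_nonneg (hd i) (diag_conj_nonneg hB U i)

/-- A Hölder inequality for the trace of a fractional power of `F * D * F`. -/
theorem trace_posPow_conj_le {U D : Matrix ι ι ℂ} {d : ι → ℝ} (hU : Uᴴ * U = 1)
    (hd : ∀ i, 0 ≤ d i) (hD : D.PosSemidef) {θ : ℝ} (h0 : 0 < θ) (h1 : θ < 1) :
    (posPow (spectralForm U d * D * spectralForm U d) θ).trace.re ≤
      (spectralForm U d * D).trace.re ^ θ * (∑ i, d i ^ (θ / (1 - θ))) ^ (1 - θ) := by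
  have hFDF : (spectralForm U d * D * spectralForm U d).PosSemidef := by
    have := hD.conjTranspose_mul_mul_same (spectralForm U d)
    rwa [(isHermitian_spectralForm U d).eq] at this
  set e : ι → ℝ := fun i => ((Uᴴ * D * U) i i).re with he
  have he0 : ∀ i, 0 ≤ e i := diag_conj_nonneg hD U
  have hUF : Uᴴ * spectralForm U d = diagonal (fun i => (d i : ℂ)) * Uᴴ := by
    rw [spectralForm, ← Matrix.mul_assoc, ← Matrix.mul_assoc, hU, Matrix.one_mul]
  have hFU : spectralForm U d * U = U * diagonal (fun i => (d i : ℂ)) := by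
    rw [spectralForm, Matrix.mul_assoc, hU, Matrix.mul_one]
  have htr := trace_spectralForm_mul_re U D d
  have hdiag : ∀ i, ((Uᴴ * (spectralForm U d * D * spectralForm U d) * U) i i).re =
      d i * e i * d i := by
    intro i
    rw [show Uᴴ * (spectralForm U d * D * spectralForm U d) * U =
      (Uᴴ * spectralForm U d) * D * (spectralForm U d * U) by simp only [Matrix.mul_assoc],
      hUF, hFU, show diagonal (fun i => (d i : ℂ)) * Uᴴ * D * (U * diagonal (fun i => (d i : ℂ)))
        = diagonal (fun i => (d i : ℂ)) * (Uᴴ * D * U) * diagonal (fun i => (d i : ℂ)) by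
        simp only [Matrix.mul_assoc], mul_diagonal, diagonal_mul, Complex.re_mul_ofReal,
        Complex.re_ofReal_mul]
  obtain ⟨V, m, hV, hVm, hm⟩ := exists_spectralForm_nonneg hFDF
  have h1θ : 0 < 1 - θ := by linarith
  calc (posPow (spectralForm U d * D * spectralForm U d) θ).trace.re
      = ∑ j, m j ^ θ := by
        rw [hVm, posPow_spectralForm hV, trace_spectralForm hV, Complex.ofReal_re]
    _ ≤ ∑ i, (d i * e i * d i) ^ θ := by
        refine (sum_rpow_le_sum_conj hU hV hm h0.le h1.le).trans_eq ?_
        rw [← hVm]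
        simp only [hdiag]
    _ = ∑ i, (d i * e i) ^ θ * d i ^ θ :=
        Finset.sum_congr rfl fun i _ => Real.mul_rpow (mul_nonneg (hd i) (he0 i)) (hd i)
    _ ≤ (∑ i, ((d i * e i) ^ θ) ^ (1 / θ)) ^ (1 / (1 / θ)) *
          (∑ i, (d i ^ θ) ^ (1 / (1 - θ))) ^ (1 / (1 / (1 - θ))) := by
        refine Real.inner_le_Lp_mul_Lq_of_nonneg _ ?_
          (fun i _ => Real.rpow_nonneg (mul_nonneg (hd i) (he0 i)) _)
          (fun i _ => Real.rpow_nonneg (hd i) _)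
        refine Real.holderConjugate_iff.mpr ⟨?_, ?_⟩
        · rw [lt_div_iff₀ h0]; linarith
        · simp
    _ = _ := by
        rw [htr, one_div_one_div, one_div_one_div]
        congr 2
        · refine Finset.sum_congr rfl fun i _ => ?_
          rw [← Real.rpow_mul (mul_nonneg (hd i) (he0 i)), mul_one_div_cancel h0.ne',
            Real.rpow_one]
        · refine Finset.sum_congr rfl fun i _ => ?_
          rw [← Real.rpow_mul (hd i), mul_one_div]

theorem schattenNorm_sqrt_conj_le {F D : Matrix ι ι ℂ} (hF : F.PosSemidef) (hD : D.PosSemidef)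
    {p L Q : ℝ} (hp0 : 1 ≤ p) (hp2 : p < 2) (hL : (F * D).trace.re ≤ L)
    (hQ : (posPow F (p / (2 - p))).trace.re ≤ Q) :
    schattenNorm p (posPow (F * D * F) (1 / 2)) ≤
      (L ^ (p / 2) * Q ^ (1 - p / 2)) ^ (1 / p) := by
  have hFDF : (F * D * F).PosSemidef := by
    have := hD.conjTranspose_mul_mul_same F
    rwa [hF.1.eq] at this
  rw [schattenNorm_sqrt hFDF]
  have hQ0 := trace_posPow_nonneg hF (p / (2 - p))
  refine Real.rpow_le_rpow (trace_posPow_nonneg hFDF _) ?_ (by positivity)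
  have hFD0 := trace_mul_nonneg hF hD
  obtain ⟨U, d, hU, rfl, hd⟩ := exists_spectralForm_nonneg hF
  refine (trace_posPow_conj_le hU hd hD (by linarith) (by linarith)).trans ?_
  rw [posPow_spectralForm hU, trace_spectralForm hU, Complex.ofReal_re] at hQ hQ0
  rw [show p / 2 / (1 - p / 2) = p / (2 - p) by
    rw [show 1 - p / 2 = (2 - p) / 2 by ring, div_div_div_cancel_right₀ two_ne_zero]]
  exact mul_le_mul (Real.rpow_le_rpow hFD0 hL (by linarith))
    (Real.rpow_le_rpow hQ0 hQ (by linarith)) (Real.rpow_nonneg hQ0 _)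
    (Real.rpow_nonneg (hFD0.trans hL) _)

end Holder

theorem tripleNorm_le_of_mem {n N : ℕ} (p : ℝ) {x a b : Fin N → Matrix (Fin n) (Fin n) ℂ}
    (h : ∀ k, x k = a k + b k) :
    tripleNorm p x ≤ schattenNorm p (posPow (∑ k, (a k)ᴴ * a k) (1/2))
        + schattenNorm p (posPow (∑ k, b k * (b k)ᴴ) (1/2)) := by
  refine csInf_le ⟨0, ?_⟩ ⟨a, b, h, rfl⟩
  rintro r ⟨a, b, -, rfl⟩
  exact add_nonneg (schattenNorm_nonneg _ _) (schattenNorm_nonneg _ _)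

/-- Bound on `tripleNorm` from a solution `y` of the Sylvester equations
`F₁ * y k + y k * F₂ = x k`. -/
theorem tripleNorm_le_of_sylvester {n N : ℕ} {p L Q : ℝ} (hp0 : 1 ≤ p) (hp2 : p < 2)
    {x y : Fin N → Matrix (Fin n) (Fin n) ℂ} {F₁ F₂ : Matrix (Fin n) (Fin n) ℂ}
    (hF₁ : F₁.PosSemidef) (hF₂ : F₂.PosSemidef) (hy : ∀ k, F₁ * y k + y k * F₂ = x k)
    (hL₁ : (F₁ * ∑ k, y k * (y k)ᴴ).trace.re ≤ L)
    (hL₂ : (F₂ * ∑ k, (y k)ᴴ * y k).trace.re ≤ L)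
    (hQ₁ : (posPow F₁ (p / (2 - p))).trace.re ≤ Q)
    (hQ₂ : (posPow F₂ (p / (2 - p))).trace.re ≤ Q) :
    tripleNorm p x ≤ 2 * (L ^ (p / 2) * Q ^ (1 - p / 2)) ^ (1 / p) := by
  refine (tripleNorm_le_of_mem p (a := fun k => y k * F₂) (b := fun k => F₁ * y k)
    (fun k => by rw [← hy k, add_comm])).trans ?_
  rw [two_mul]
  refine add_le_add ?_ ?_
  · have : ∑ k, (y k * F₂)ᴴ * (y k * F₂) = F₂ * (∑ k, (y k)ᴴ * y k) * F₂ := by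
      simp only [conjTranspose_mul, hF₂.1.eq, Finset.mul_sum, Finset.sum_mul, Matrix.mul_assoc]
    rw [this]
    exact schattenNorm_sqrt_conj_le hF₂ (posSemidef_sum _ fun k _ =>
      posSemidef_conjTranspose_mul_self _) hp0 hp2 hL₂ hQ₂
  · have : ∑ k, (F₁ * y k) * (F₁ * y k)ᴴ = F₁ * (∑ k, y k * (y k)ᴴ) * F₁ := by
      simp only [conjTranspose_mul, hF₁.1.eq, Finset.mul_sum, Finset.sum_mul, Matrix.mul_assoc]
    rw [this]
    exact schattenNorm_sqrt_conj_le hF₁ (posSemidef_sum _ fun k _ =>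
      posSemidef_self_mul_conjTranspose _) hp0 hp2 hL₁ hQ₁

section HilbertSchmidt

variable {ι : Type*} [Fintype ι] [DecidableEq ι]

/-- The Hilbert–Schmidt inner product is invariant under unitary changes of bases. -/
theorem trace_mul_conjTranspose_eq {U V : Matrix ι ι ℂ} (hU : Uᴴ * U = 1) (hV : Vᴴ * V = 1)
    (A B : Matrix ι ι ℂ) :
    (A * Bᴴ).trace = ∑ i, ∑ j, (Uᴴ * A * V) i j * star ((Uᴴ * B * V) i j) := by
  have : (A * Bᴴ).trace = ((Uᴴ * A * V) * (Uᴴ * B * V)ᴴ).trace := by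
    rw [conjTranspose_mul, conjTranspose_mul, conjTranspose_conjTranspose,
      show Uᴴ * A * V * (Vᴴ * (Bᴴ * U)) = Uᴴ * (A * (V * Vᴴ) * Bᴴ * U) by
        simp only [Matrix.mul_assoc], mul_eq_one_comm.mp hV, Matrix.mul_one,
      trace_mul_comm Uᴴ, Matrix.mul_assoc _ U, mul_eq_one_comm.mp hU, Matrix.mul_one]
  rw [this, trace]
  simp only [diag_apply, mul_apply (M := Uᴴ * A * V), conjTranspose_apply]

theorem conj_spectralForm_mul_apply {U : Matrix ι ι ℂ} (hU : Uᴴ * U = 1) (V W : Matrix ι ι ℂ)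
    (a : ι → ℝ) (i j : ι) :
    (Uᴴ * (spectralForm U a * W) * V) i j = a i * (Uᴴ * W * V) i j := by
  rw [show Uᴴ * (spectralForm U a * W) * V =
    (Uᴴ * U) * (diagonal (fun i => (a i : ℂ)) * (Uᴴ * W * V)) by
      simp only [spectralForm, Matrix.mul_assoc], hU, Matrix.one_mul, diagonal_mul]

theorem conj_mul_spectralForm_apply {V : Matrix ι ι ℂ} (hV : Vᴴ * V = 1) (U W : Matrix ι ι ℂ)
    (b : ι → ℝ) (i j : ι) :
    (Uᴴ * (W * spectralForm V b) * V) i j = (Uᴴ * W * V) i j * b j := by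
  rw [show Uᴴ * (W * spectralForm V b) * V =
    (Uᴴ * W * V) * diagonal (fun i => (b i : ℂ)) * (Vᴴ * V) by
      simp only [spectralForm, Matrix.mul_assoc], hV, Matrix.mul_one, mul_diagonal]

theorem conj_spectralForm_left_apply {U : Matrix ι ι ℂ} (hU : Uᴴ * U = 1) (V : Matrix ι ι ℂ)
    (a : ι → ℝ) (i j : ι) : (Uᴴ * spectralForm U a * V) i j = a i * (Uᴴ * V) i j := by
  simpa using conj_spectralForm_mul_apply hU V 1 a i j

theorem conj_spectralForm_right_apply {V : Matrix ι ι ℂ} (hV : Vᴴ * V = 1) (U : Matrix ι ι ℂ)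
    (b : ι → ℝ) (i j : ι) : (Uᴴ * spectralForm V b * V) i j = (Uᴴ * V) i j * b j := by
  simpa using conj_mul_spectralForm_apply hV U 1 b i j

theorem isHermitian_hermFun (A : Matrix ι ι ℂ) (f : ℝ → ℝ) : (hermFun A f).IsHermitian := by
  by_cases hA : A.IsHermitian
  · obtain ⟨U, d, -, -, h⟩ := exists_spectralForm hA
    rw [h]
    exact isHermitian_spectralForm _ _
  · rw [hermFun, dif_neg hA]
    exact isHermitian_zero

theorem posSemidef_spectralForm {U : Matrix ι ι ℂ} {d : ι → ℝ} (hd : ∀ i, 0 ≤ d i) :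
    (spectralForm U d).PosSemidef := by
  unfold spectralForm
  refine PosSemidef.mul_mul_conjTranspose_same (posSemidef_diagonal_iff.mpr fun i => ?_) U
  exact_mod_cast hd i

theorem posSemidef_hermFun (A : Matrix ι ι ℂ) {f : ℝ → ℝ} (hf : ∀ t, 0 ≤ f t) :
    (hermFun A f).PosSemidef := by
  by_cases hA : A.IsHermitian
  · obtain ⟨U, d, -, -, h⟩ := exists_spectralForm hA
    rw [h]
    exact posSemidef_spectralForm fun i => hf _
  · rw [hermFun, dif_neg hA]
    exact PosSemidef.zero

theorem trace_hermFun_eq {A : Matrix ι ι ℂ} (hA : A.IsHermitian) (f : ℝ → ℝ) :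
    (hermFun A f).trace.re = ∑ i, f (hA.eigenvalues i) := by
  rw [hermFun, dif_pos hA, IsHermitian.cfc, Unitary.conjStarAlgAut_apply]
  have := trace_spectralForm (U := (hA.eigenvectorUnitary : Matrix ι ι ℂ))
    (Unitary.coe_star_mul_self hA.eigenvectorUnitary) (fun i => f (hA.eigenvalues i))
  exact (congrArg Complex.re this).trans (Complex.ofReal_re _)

theorem mul_hermFun {A : Matrix ι ι ℂ} (hA : A.IsHermitian) (f : ℝ → ℝ) :
    A * hermFun A f = hermFun A (fun t => t * f t) := by
  obtain ⟨U, d, hU, h, hf⟩ := exists_spectralForm hA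
  rw [hf, hf]
  conv_lhs => rw [h]
  exact spectralForm_mul hU _ _

theorem hermFun_mul_self {A : Matrix ι ι ℂ} (hA : A.IsHermitian) (f : ℝ → ℝ) :
    hermFun (A * A) f = hermFun A (fun t => f (t * t)) := by
  obtain ⟨U, d, hU, h, hf⟩ := exists_spectralForm hA
  rw [hf, h, spectralForm_mul hU, hermFun_spectralForm hU]

theorem trace_hermFun_mul_comm (S : Matrix ι ι ℂ) (f : ℝ → ℝ) :
    (hermFun (S * Sᴴ) f).trace.re = (hermFun (Sᴴ * S) f).trace.re := by
  have h1 : (S * Sᴴ).IsHermitian := isHermitian_mul_conjTranspose_self S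
  have h2 : (Sᴴ * S).IsHermitian := isHermitian_conjTranspose_mul_self S
  rw [trace_hermFun_eq h1, trace_hermFun_eq h2]
  have h := congrArg Polynomial.roots (charpoly_mul_comm S Sᴴ)
  rw [h1.roots_charpoly_eq_eigenvalues, h2.roots_charpoly_eq_eigenvalues] at h
  have := congrArg (fun m => (m.map (fun z : ℂ => f z.re)).sum) h
  rw [Multiset.map_map, Multiset.map_map] at this
  exact this

/-- Solution of a Sylvester equation. -/
theorem exists_sylvester {F₁ F₂ : Matrix ι ι ℂ} {η : ℝ} (hη : 0 < η)
    (h₁ : (F₁ - (η : ℂ) • (1 : Matrix ι ι ℂ)).PosSemidef)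
    (h₂ : (F₂ - (η : ℂ) • (1 : Matrix ι ι ℂ)).PosSemidef) (x : Matrix ι ι ℂ) :
    ∃ y, F₁ * y + y * F₂ = x := by
  have key : ∀ F : Matrix ι ι ℂ, (F - (η : ℂ) • (1 : Matrix ι ι ℂ)).PosSemidef →
      ∃ (U : Matrix ι ι ℂ) (d : ι → ℝ), Uᴴ * U = 1 ∧ F = spectralForm U d ∧ ∀ i, 0 < d i := by
    intro F h
    obtain ⟨U, d, hU, hd, h0⟩ := exists_spectralForm_nonneg h
    refine ⟨U, fun i => d i + η, hU, ?_, fun i => by have := h0 i; positivity⟩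
    rw [← spectralForm_add, ← hd]
    have : spectralForm U (fun _ => η) = (η : ℂ) • (1 : Matrix ι ι ℂ) := by
      rw [← spectralForm_one hU, spectralForm, spectralForm, ← Matrix.smul_mul, ← Matrix.mul_smul]
      congr 2
      ext i j
      by_cases hij : i = j <;> simp [hij]
    rw [this, sub_add_cancel]
  obtain ⟨U, d, hU, rfl, hd⟩ := key F₁ h₁
  obtain ⟨V, e, hV, rfl, he⟩ := key F₂ h₂
  set Z : Matrix ι ι ℂ := Matrix.of fun i j => (Uᴴ * x * V) i j / (d i + e j)
  refine ⟨U * Z * Vᴴ, ?_⟩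
  have hZ : diagonal (fun i => (d i : ℂ)) * Z + Z * diagonal (fun i => (e i : ℂ)) =
      Uᴴ * x * V := by
    ext i j
    have : (d i : ℂ) + e j ≠ 0 := by
      have := hd i
      have := he j
      exact_mod_cast (by positivity : d i + e j ≠ 0)
    rw [Matrix.add_apply, diagonal_mul, mul_diagonal]
    simp only [Z, Matrix.of_apply]
    field_simp
  calc spectralForm U d * (U * Z * Vᴴ) + U * Z * Vᴴ * spectralForm V e
      = U * (diagonal (fun i => (d i : ℂ)) * (Uᴴ * U) * Z +
          Z * (Vᴴ * V) * diagonal (fun i => (e i : ℂ))) * Vᴴ := by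
        simp only [spectralForm, Matrix.mul_assoc, Matrix.mul_add, Matrix.add_mul]
    _ = (U * Uᴴ) * x * (V * Vᴴ) := by
        rw [hU, hV, Matrix.mul_one, Matrix.mul_one, hZ]
        simp only [Matrix.mul_assoc]
    _ = x := by
        rw [mul_eq_one_comm.mp hU, mul_eq_one_comm.mp hV, Matrix.one_mul, Matrix.mul_one]

end HilbertSchmidt

section Dilation

variable {ι : Type*} [Fintype ι] [DecidableEq ι]

theorem trace_fromBlocks_eq {ι : Type*} [Fintype ι] (A B C D : Matrix ι ι ℂ) :
    (fromBlocks A B C D).trace = A.trace + D.trace := by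
  simp [trace]

/-- The Hermitian dilation of a matrix. -/
def dilation {ι : Type*} (S : Matrix ι ι ℂ) : Matrix (ι ⊕ ι) (ι ⊕ ι) ℂ := fromBlocks 0 S Sᴴ 0

theorem isHermitian_dilation {ι : Type*} (S : Matrix ι ι ℂ) : (dilation S).IsHermitian := by
  simp [dilation, IsHermitian, fromBlocks_conjTranspose]

theorem dilation_mul {ι : Type*} [Fintype ι] (S T : Matrix ι ι ℂ) :
    dilation S * dilation T = fromBlocks (S * Tᴴ) 0 0 (Sᴴ * T) := by
  simp [dilation, fromBlocks_multiply]

theorem hermFun_fromBlocks {A B : Matrix ι ι ℂ} (hA : A.IsHermitian) (hB : B.IsHermitian)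
    (f : ℝ → ℝ) :
    hermFun (fromBlocks A 0 0 B) f = fromBlocks (hermFun A f) 0 0 (hermFun B f) := by
  obtain ⟨U, d, hU, rfl, hf⟩ := exists_spectralForm hA
  obtain ⟨V, e, hV, rfl, hg⟩ := exists_spectralForm hB
  have key : ∀ d e : ι → ℝ, fromBlocks (spectralForm U d) 0 0 (spectralForm V e) =
      spectralForm (fromBlocks U 0 0 V) (Sum.elim d e) := by
    intro d e
    have : diagonal (fun i => ((Sum.elim d e i : ℝ) : ℂ)) =
        fromBlocks (diagonal fun i => (d i : ℂ)) 0 0 (diagonal fun i => (e i : ℂ)) := by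
      rw [fromBlocks_diagonal]
      congr 1
      ext i
      cases i <;> rfl
    simp only [spectralForm, this, fromBlocks_conjTranspose, fromBlocks_multiply]
    simp
  have hW : (fromBlocks U 0 0 V)ᴴ * fromBlocks U 0 0 V = 1 := by
    simp [fromBlocks_conjTranspose, fromBlocks_multiply, hU, hV]
  rw [hf, hg, key, key, hermFun_spectralForm hW]
  congr 1
  ext i
  cases i <;> rfl

theorem trace_hermFun_dilation (S : Matrix ι ι ℂ) (p : ℝ) :
    (hermFun (dilation S) (fun t => |t| ^ p)).trace.re =
      2 * (posPow (Sᴴ * S) (p / 2)).trace.re := by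
  have : (fun t : ℝ => |t| ^ p) = fun t => (t * t) ^ (p / 2) := by
    ext t
    rw [← abs_mul_abs_self, ← sq, ← Real.rpow_natCast, ← Real.rpow_mul (abs_nonneg t)]
    congr 1
    push_cast
    ring
  rw [this, ← hermFun_mul_self (isHermitian_dilation S) (fun t => t ^ (p / 2)), dilation_mul,
    hermFun_fromBlocks (isHermitian_mul_conjTranspose_self S)
      (isHermitian_conjTranspose_mul_self S), trace_fromBlocks_eq, Complex.add_re,
    trace_hermFun_mul_comm, posPow_eq_hermFun, two_mul]

end Dilation

section Monotone

theorem mul_sub_le_rpow_sub_mul {a x y : ℝ} (h0 : 0 < a) (h1 : a < 1) (hy : 0 ≤ y) (hxy : y ≤ x) :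
    a * (x - y) ≤ (x ^ a - y ^ a) * (x ^ (1 - a) + y ^ (1 - a)) := by
  have hx := hy.trans hxy
  have e : x ^ a * x ^ (1 - a) = x := by
    rw [← Real.rpow_add' hx (by norm_num), add_sub_cancel, Real.rpow_one]
  have h2 := Real.geom_mean_le_arith_mean2_weighted h0.le (sub_nonneg.mpr h1.le) hy hx (by ring)
  have h3 : 0 ≤ (x ^ a - y ^ a) * y ^ (1 - a) :=
    mul_nonneg (sub_nonneg.mpr (Real.rpow_le_rpow hy hxy h0.le)) (Real.rpow_nonneg hy _)
  nlinarith

theorem add_le_rpow_add_mul {a x z : ℝ} (hx : 0 ≤ x) (hz : 0 ≤ z) :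
    x + z ≤ (x ^ a + z ^ a) * (x ^ (1 - a) + z ^ (1 - a)) := by
  have e : ∀ {x : ℝ}, 0 ≤ x → x ^ a * x ^ (1 - a) = x := fun hx => by
    rw [← Real.rpow_add' hx (by norm_num), add_sub_cancel, Real.rpow_one]
  have h1 := mul_nonneg (Real.rpow_nonneg hx a) (Real.rpow_nonneg hz (1 - a))
  have h2 := mul_nonneg (Real.rpow_nonneg hz a) (Real.rpow_nonneg hx (1 - a))
  nlinarith [e hx, e hz]

/-- The odd extension of `t ↦ t ^ (p - 1)`. -/
noncomputable def signedPow (p t : ℝ) : ℝ := t * |t| ^ (p - 2)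

theorem mul_signedPow {p : ℝ} (hp : p ≠ 0) (t : ℝ) : t * signedPow p t = |t| ^ p := by
  rcases eq_or_ne t 0 with rfl | ht
  · simp [Real.zero_rpow hp]
  · rw [signedPow, ← mul_assoc, ← abs_mul_abs_self, ← sq, ← Real.rpow_natCast,
      ← Real.rpow_add (abs_pos.mpr ht)]
    congr 1
    push_cast
    ring

theorem signedPow_of_nonneg {p t : ℝ} (hp : 1 < p) (ht : 0 ≤ t) :
    signedPow p t = t ^ (p - 1) := by
  rcases ht.eq_or_lt with rfl | ht
  · simp [signedPow, Real.zero_rpow (sub_pos.mpr hp).ne']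
  · rw [signedPow, abs_of_pos ht, ← Real.rpow_one_add' ht.le (by linarith)]
    congr 1
    ring

theorem signedPow_neg (p t : ℝ) : signedPow p (-t) = -signedPow p t := by
  simp [signedPow]

theorem mul_sq_le_signedPow {p : ℝ} (hp1 : 1 < p) (hp2 : p < 2) (x y : ℝ) :
    (p - 1) * (x - y) ^ 2 ≤
      (x - y) * (signedPow p x - signedPow p y) * (|x| ^ (2 - p) + |y| ^ (2 - p)) := by
  have e : 2 - p = 1 - (p - 1) := by ring
  have same : ∀ {x y : ℝ}, 0 ≤ y → y ≤ x → (p - 1) * (x - y) ^ 2 ≤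
      (x - y) * (signedPow p x - signedPow p y) * (|x| ^ (2 - p) + |y| ^ (2 - p)) := by
    intro x y hy hxy
    have h := mul_sub_le_rpow_sub_mul (sub_pos.mpr hp1) (by linarith) hy hxy
    rw [signedPow_of_nonneg hp1 hy, signedPow_of_nonneg hp1 (hy.trans hxy), abs_of_nonneg hy,
      abs_of_nonneg (hy.trans hxy), e]
    nlinarith [mul_le_mul_of_nonneg_left h (sub_nonneg.mpr hxy)]
  have same' : ∀ {x y : ℝ}, 0 ≤ y → 0 ≤ x → (p - 1) * (x - y) ^ 2 ≤
      (x - y) * (signedPow p x - signedPow p y) * (|x| ^ (2 - p) + |y| ^ (2 - p)) := by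
    intro x y hy hx
    rcases le_total y x with h | h
    · exact same hy h
    · have := same hx h
      linarith
  have opp : ∀ {x z : ℝ}, 0 ≤ x → 0 ≤ z → (p - 1) * (x - -z) ^ 2 ≤
      (x - -z) * (signedPow p x - signedPow p (-z)) * (|x| ^ (2 - p) + |(-z)| ^ (2 - p)) := by
    intro x z hx hz
    have h := add_le_rpow_add_mul (a := p - 1) hx hz
    rw [signedPow_neg, signedPow_of_nonneg hp1 hx, signedPow_of_nonneg hp1 hz, abs_neg,
      abs_of_nonneg hx, abs_of_nonneg hz, e, sub_neg_eq_add, sub_neg_eq_add]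
    have h3 : 0 ≤ x + z := add_nonneg hx hz
    nlinarith [mul_le_mul_of_nonneg_left h h3, mul_nonneg (by linarith : 0 ≤ 2 - p) (mul_nonneg h3 h3)]
  rcases le_total 0 x with hx | hx <;> rcases le_total 0 y with hy | hy
  · exact same' hy hx
  · simpa using opp hx (neg_nonneg.mpr hy)
  · have := opp hy (neg_nonneg.mpr hx)
    rw [neg_neg] at this
    linarith
  · have := same' (neg_nonneg.mpr hy) (neg_nonneg.mpr hx)
    simp only [signedPow_neg, abs_neg] at this
    linarith

/-- Quantitative monotonicity of `signedPow p` in linearized form. -/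
theorem signedPow_linearized {p : ℝ} (hp1 : 1 < p) (hp2 : p < 2) (x y : ℝ) (o w : ℂ) :
    (p - 1) * (2 * ((x - y) * (o * star w).re) -
        (|x| ^ (2 - p) * ‖w‖ ^ 2 + |y| ^ (2 - p) * ‖w‖ ^ 2)) ≤
      (x - y) * (signedPow p x - signedPow p y) * ‖o‖ ^ 2 := by
  have hmain := mul_sq_le_signedPow hp1 hp2 x y
  set A := |x| ^ (2 - p) + |y| ^ (2 - p) with hA
  set P := (x - y) * (signedPow p x - signedPow p y)
  have hx : 0 ≤ |x| ^ (2 - p) := by positivity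
  have hy : 0 ≤ |y| ^ (2 - p) := by positivity
  have hre : |(o * star w).re| ≤ ‖o‖ * ‖w‖ := by
    simpa using Complex.abs_re_le_norm (o * star w)
  rcases (add_nonneg hx hy).eq_or_lt with h0 | hpos
  · have hx0 : |x| ^ (2 - p) = 0 := by linarith
    have hy0 : |y| ^ (2 - p) = 0 := by linarith
    rw [Real.rpow_eq_zero (abs_nonneg _) (by linarith), abs_eq_zero] at hx0 hy0
    subst hx0 hy0
    have : (0 : ℝ) ^ (2 - p) = 0 := Real.zero_rpow (by linarith)
    simp [this, P]
  · have hk : 0 < p - 1 := by linarith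
    have h1 : 2 * ((x - y) * (o * star w).re) * A ≤ (x - y) ^ 2 * ‖o‖ ^ 2 + A ^ 2 * ‖w‖ ^ 2 := by
      have : (x - y) * (o * star w).re ≤ |x - y| * (‖o‖ * ‖w‖) :=
        (le_abs_self _).trans (by rw [abs_mul]; gcongr)
      rw [← sq_abs (x - y)]
      nlinarith [sq_nonneg (|x - y| * ‖o‖ - A * ‖w‖), mul_le_mul_of_nonneg_right this hpos.le]
    refine le_of_mul_le_mul_right ?_ hpos
    have h2 := mul_le_mul_of_nonneg_right hmain (sq_nonneg ‖o‖)
    have h3 := mul_le_mul_of_nonneg_left h1 hk.le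
    calc _ = (p - 1) * (2 * ((x - y) * (o * star w).re) * A) - (p - 1) * (A ^ 2 * ‖w‖ ^ 2) := by
          rw [hA]; ring
      _ ≤ P * A * ‖o‖ ^ 2 := by linarith
      _ = _ := by rw [hA]; ring

variable {ι : Type*} [Fintype ι] [DecidableEq ι]

theorem trace_signedPow_linearized {p : ℝ} (hp1 : 1 < p) (hp2 : p < 2) {X Y : Matrix ι ι ℂ}
    (hX : X.IsHermitian) (hY : Y.IsHermitian) (W : Matrix ι ι ℂ) :
    (p - 1) * (2 * ((X - Y) * Wᴴ).trace.re -
        ((hermFun X (fun t => |t| ^ (2 - p)) * W * Wᴴ).trace.re +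
          (W * hermFun Y (fun t => |t| ^ (2 - p)) * Wᴴ).trace.re)) ≤
      ((X - Y) * (hermFun X (signedPow p) - hermFun Y (signedPow p))).trace.re := by
  have hH : (hermFun X (signedPow p) - hermFun Y (signedPow p)) =
      (hermFun X (signedPow p) - hermFun Y (signedPow p))ᴴ :=
    ((isHermitian_hermFun _ _).sub (isHermitian_hermFun _ _)).eq.symm
  rw [hH]
  obtain ⟨U, d, hU, rfl, hf⟩ := exists_spectralForm hX
  obtain ⟨V, e, hV, rfl, hg⟩ := exists_spectralForm hY
  simp only [hf, hg, trace_mul_conjTranspose_eq hU hV]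
  simp only [Matrix.mul_sub, Matrix.sub_mul,
    Matrix.sub_apply, conj_spectralForm_mul_apply hU, conj_mul_spectralForm_apply hV,
    conj_spectralForm_left_apply hU, conj_spectralForm_right_apply hV, Complex.re_sum,
    Finset.mul_sum, ← Finset.sum_add_distrib, ← Finset.sum_sub_distrib]
  refine Finset.sum_le_sum fun i _ => Finset.sum_le_sum fun j _ => ?_
  have h := signedPow_linearized hp1 hp2 (d i) (e j) ((Uᴴ * V) i j) ((Uᴴ * W * V) i j)
  generalize (Uᴴ * V) i j = o at h ⊢
  generalize (Uᴴ * W * V) i j = w at h ⊢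
  have hn : ∀ z : ℂ, ‖z‖ ^ 2 = z.re ^ 2 + z.im ^ 2 := fun z => by
    rw [← Complex.normSq_eq_norm_sq, Complex.normSq_apply]; ring
  simp only [hn] at h
  simp at h ⊢
  linarith

end Monotone

section SignSum

variable {ι : Type*} {N : ℕ}

/-- The signed sum `∑ ε_k x_k`. -/
noncomputable def signSum (x : Fin N → Matrix ι ι ℂ) (ε : Fin N → Bool) : Matrix ι ι ℂ :=
  ∑ k, (if ε k then (1 : ℂ) else -1) • x k

theorem isHermitian_signSum {x : Fin N → Matrix ι ι ℂ} (hx : ∀ k, (x k).IsHermitian)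
    (ε : Fin N → Bool) : (signSum x ε).IsHermitian := by
  unfold IsHermitian signSum
  rw [conjTranspose_sum]
  refine Finset.sum_congr rfl fun k _ => ?_
  rw [conjTranspose_smul, (hx k).eq]
  cases ε k <;> simp

theorem dilation_sum (x : Fin N → Matrix ι ι ℂ) :
    dilation (∑ k, x k) = ∑ k, dilation (x k) := by
  ext i j
  rcases i with i | i <;> rcases j with j | j <;> simp [dilation, Matrix.sum_apply]

theorem dilation_signSum (x : Fin N → Matrix ι ι ℂ) (ε : Fin N → Bool) :
    dilation (signSum x ε) = signSum (fun k => dilation (x k)) ε := by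
  rw [signSum, dilation_sum, signSum]
  refine Finset.sum_congr rfl fun k _ => ?_
  cases ε k <;> simp [dilation, fromBlocks_neg]

/-- The sign vector with its `k`-th sign reversed. -/
def flipSign (k : Fin N) (ε : Fin N → Bool) : Fin N → Bool := Function.update ε k (!ε k)

theorem flipSign_flipSign (k : Fin N) (ε : Fin N → Bool) : flipSign k (flipSign k ε) = ε := by
  simp [flipSign]

theorem sum_flipSign {M : Type*} [AddCommMonoid M] (k : Fin N) (f : (Fin N → Bool) → M) :
    ∑ ε, f (flipSign k ε) = ∑ ε, f ε :=
  Equiv.sum_comp (Function.Involutive.toPerm (flipSign k) (flipSign_flipSign k)) f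

theorem signSum_sub_flipSign (x : Fin N → Matrix ι ι ℂ) (k : Fin N) (ε : Fin N → Bool) :
    signSum x ε - signSum x (flipSign k ε) = (2 : ℂ) • (if ε k then (1 : ℂ) else -1) • x k := by
  unfold signSum
  rw [← Finset.sum_sub_distrib, Finset.sum_eq_single k]
  · cases h : ε k <;> simp [flipSign, h, two_smul, sub_eq_add_neg]
  · intro j _ hj
    simp [flipSign, hj]
  · simp

variable [Fintype ι]

theorem sum_trace_signSum_mul {x : Fin N → Matrix ι ι ℂ} (T : (Fin N → Bool) → Matrix ι ι ℂ) :
    ∑ ε, (signSum x ε * T ε).trace.re = 1 / 4 * ∑ k, ∑ ε,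
      ((signSum x ε - signSum x (flipSign k ε)) * (T ε - T (flipSign k ε))).trace.re := by
  have key : ∀ k, ∑ ε, ((signSum x ε - signSum x (flipSign k ε)) *
      (T ε - T (flipSign k ε))).trace.re =
      4 * ∑ ε, (((if ε k then (1 : ℂ) else -1) • x k) * T ε).trace.re := by
    intro k
    have h1 : ∑ ε, (((if ε k then (1 : ℂ) else -1) • x k) * T (flipSign k ε)).trace.re =
        -∑ ε, (((if ε k then (1 : ℂ) else -1) • x k) * T ε).trace.re := by
      rw [← sum_flipSign k, ← Finset.sum_neg_distrib]
      refine Finset.sum_congr rfl fun ε _ => ?_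
      rw [flipSign_flipSign]
      cases h : ε k <;> simp [flipSign, h]
    calc _ = ∑ ε, (2 * (((if ε k then (1 : ℂ) else -1) • x k) * T ε).trace.re -
        2 * (((if ε k then (1 : ℂ) else -1) • x k) * T (flipSign k ε)).trace.re) := by
          refine Finset.sum_congr rfl fun ε _ => ?_
          rw [signSum_sub_flipSign, Matrix.smul_mul, trace_smul, Matrix.mul_sub, trace_sub]
          simp only [smul_eq_mul, Complex.mul_re, Complex.sub_re, Complex.re_ofNat,
            Complex.im_ofNat]
          ring
      _ = _ := by
          rw [Finset.sum_sub_distrib, ← Finset.mul_sum, ← Finset.mul_sum, h1]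
          ring
  simp only [key]
  rw [← Finset.mul_sum, ← mul_assoc, show (1 / 4 * 4 : ℝ) = 1 by norm_num, one_mul,
    Finset.sum_comm]
  refine Finset.sum_congr rfl fun ε _ => ?_
  rw [signSum, Finset.sum_mul, trace_sum, Complex.re_sum]

variable [DecidableEq ι]

theorem sum_trace_abs_rpow_ge {p : ℝ} (hp1 : 1 < p) (hp2 : p < 2) {x y : Fin N → Matrix ι ι ℂ}
    (hx : ∀ k, (x k).IsHermitian) (hy : ∀ k, (y k).IsHermitian) :
    (p - 1) * (2 * 2 ^ N * ∑ k, (x k * y k).trace.re - 2 * ∑ k,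
      ((∑ ε, hermFun (signSum x ε) (fun t => |t| ^ (2 - p))) * (y k * y k)).trace.re) ≤
    ∑ ε, (hermFun (signSum x ε) (fun t => |t| ^ p)).trace.re := by
  have hS := isHermitian_signSum hx
  have h1 : ∑ ε, (hermFun (signSum x ε) (fun t => |t| ^ p)).trace.re =
      ∑ ε, (signSum x ε * hermFun (signSum x ε) (signedPow p)).trace.re := by
    refine Finset.sum_congr rfl fun ε _ => ?_
    rw [mul_hermFun (hS ε)]
    simp only [mul_signedPow (by linarith : p ≠ 0)]
  rw [h1, sum_trace_signSum_mul]
  set H : (Fin N → Bool) → Matrix ι ι ℂ := fun ε => hermFun (signSum x ε) (fun t => |t| ^ (2 - p))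
    with hH
  have h2 : ∀ k ε, (p - 1) * (8 * (x k * y k).trace.re - (4 * (H ε * (y k * y k)).trace.re +
      4 * (H (flipSign k ε) * (y k * y k)).trace.re)) ≤
      ((signSum x ε - signSum x (flipSign k ε)) * (hermFun (signSum x ε) (signedPow p) -
        hermFun (signSum x (flipSign k ε)) (signedPow p))).trace.re := by
    intro k ε
    refine le_trans (le_of_eq ?_) (trace_signedPow_linearized hp1 hp2 (hS ε) (hS (flipSign k ε))
      ((2 : ℂ) • (if ε k then (1 : ℂ) else -1) • y k))
    rw [signSum_sub_flipSign, trace_mul_cycle _ (hermFun (signSum x (flipSign k ε)) _) _,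
      trace_mul_cycle _ _ (hermFun (signSum x (flipSign k ε)) _)]
    congr 1
    cases ε k <;>
    · simp only [conjTranspose_smul, (hy k).eq, Matrix.smul_mul, Matrix.mul_smul, trace_smul, hH,
        Matrix.mul_assoc]
      simp
      ring
  calc _ = 1 / 4 * ∑ k, ∑ ε, (p - 1) * (8 * (x k * y k).trace.re -
      (4 * (H ε * (y k * y k)).trace.re + 4 * (H (flipSign k ε) * (y k * y k)).trace.re)) := by
        simp only [← Finset.mul_sum, Finset.sum_sub_distrib, Finset.sum_add_distrib]
        have h3 : ∀ k, ∑ ε, (H ε * (y k * y k)).trace.re =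
            ((∑ ε, H ε) * (y k * y k)).trace.re := fun k => by
          rw [Finset.sum_mul, trace_sum, Complex.re_sum]
        have h4 : ∀ k, ∑ ε, (H (flipSign k ε) * (y k * y k)).trace.re =
            ((∑ ε, H ε) * (y k * y k)).trace.re := fun k => by
          rw [← h3, sum_flipSign k (fun ε => (H ε * (y k * y k)).trace.re)]
        simp only [h3, h4]
        simp [← Finset.mul_sum]
        ring
    _ ≤ _ := by
        refine mul_le_mul_of_nonneg_left ?_ (by norm_num)
        exact Finset.sum_le_sum fun k _ => Finset.sum_le_sum fun ε _ => h2 k ε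

theorem radAvg_eq_dilation {n : ℕ} {p : ℝ} (hp : p ≠ 0) (x : Fin N → Matrix (Fin n) (Fin n) ℂ) :
    ∑ ε, (hermFun (signSum (fun k => dilation (x k)) ε) (fun t => |t| ^ p)).trace.re =
      2 * 2 ^ N * radAvg p x := by
  simp only [← dilation_signSum, trace_hermFun_dilation, ← schattenNorm_rpow hp]
  rw [← Finset.mul_sum, radAvg]
  simp only [signSum]
  field_simp

theorem radAvg_nonneg {n : ℕ} (p : ℝ) (x : Fin N → Matrix (Fin n) (Fin n) ℂ) :
    0 ≤ radAvg p x :=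
  mul_nonneg (by positivity)
    (Finset.sum_nonneg fun _ _ => Real.rpow_nonneg (schattenNorm_nonneg _ _) _)

end SignSum

section OneLt

variable {ι κ : Type*} [Fintype ι] [Fintype κ] [DecidableEq κ] {N : ℕ}

theorem add_rpow_le {s a b : ℝ} (hs : 1 ≤ s) (ha : 0 ≤ a) (hb : 0 ≤ b) :
    (a + b) ^ s ≤ 2 ^ (s - 1) * (a ^ s + b ^ s) := by
  lift a to NNReal using ha
  lift b to NNReal using hb
  exact_mod_cast NNReal.rpow_add_le_mul_rpow_add_rpow a b hs

theorem average_rpow_le {s : ℝ} (hs : 1 ≤ s) {a : (Fin N → Bool) → ℝ} (ha : ∀ ε, 0 ≤ a ε) :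
    (1 / 2 ^ N * ∑ ε, a ε) ^ s ≤ 1 / 2 ^ N * ∑ ε, a ε ^ s := by
  have := (convexOn_rpow hs).map_sum_le (t := Finset.univ)
    (w := fun _ : Fin N → Bool => (1 / 2 ^ N : ℝ))
    (p := a) (fun j _ => by positivity) (by simp) (fun j _ => ha j)
  simpa only [Finset.mul_sum, smul_eq_mul] using this

theorem sum_rpow_average_diag_le {W : Matrix κ κ ℂ} (hW : Wᴴ * W = 1)
    {S : (Fin N → Bool) → Matrix κ κ ℂ} (hS : ∀ ε, (S ε).IsHermitian) {σ : ι → κ}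
    (hσ : Function.Injective σ) {η p : ℝ} (hη : 0 ≤ η) (hp1 : 1 ≤ p) (hp2 : p < 2) :
    ∑ i, (1 / 2 ^ N * ∑ ε, ((Wᴴ * hermFun (S ε) (fun t => |t| ^ (2 - p)) * W) (σ i) (σ i)).re + η)
        ^ (p / (2 - p)) ≤
      2 ^ (p / (2 - p) - 1) * (1 / 2 ^ N * ∑ ε, (hermFun (S ε) (fun t => |t| ^ p)).trace.re +
        Fintype.card ι * η ^ (p / (2 - p))) := by
  set s := p / (2 - p) with hs_def
  have hs : 1 ≤ s := by
    rw [hs_def, le_div_iff₀ (by linarith)]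
    linarith
  have hpow : ∀ t : ℝ, (|t| ^ (2 - p)) ^ s = |t| ^ p := fun t => by
    rw [← Real.rpow_mul (abs_nonneg t), hs_def, mul_div_cancel₀ _ (by linarith : 2 - p ≠ 0)]
  set a : (Fin N → Bool) → ι → ℝ := fun ε i =>
    ((Wᴴ * hermFun (S ε) (fun t => |t| ^ (2 - p)) * W) (σ i) (σ i)).re
  have ha : ∀ ε i, 0 ≤ a ε i := fun ε i =>
    diag_conj_nonneg (posSemidef_hermFun _ fun t => Real.rpow_nonneg (abs_nonneg t) _) W _
  have hsum : ∀ ε, ∑ i, a ε i ^ s ≤ (hermFun (S ε) (fun t => |t| ^ p)).trace.re := by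
    intro ε
    obtain ⟨V, m, hV, -, hf⟩ := exists_spectralForm (hS ε)
    calc ∑ i, a ε i ^ s
        ≤ ∑ i, ((Wᴴ * hermFun (S ε) (fun t => |t| ^ p) * W) (σ i) (σ i)).re := by
          refine Finset.sum_le_sum fun i _ => ?_
          have := rpow_conj_spectralForm_le hW hV (m := fun j => |m j| ^ (2 - p))
            (fun j => Real.rpow_nonneg (abs_nonneg _) _) hs (σ i)
          simp only [hpow] at this
          simpa only [a, hf] using this
      _ ≤ ∑ j, ((Wᴴ * hermFun (S ε) (fun t => |t| ^ p) * W) j j).re := by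
          rw [← Finset.sum_image (f := fun j => ((Wᴴ * hermFun (S ε) (fun t => |t| ^ p) * W) j j).re)
            (s := Finset.univ) (g := σ) (fun x _ y _ h => hσ h)]
          refine Finset.sum_le_sum_of_subset_of_nonneg (Finset.subset_univ _) fun j _ _ => ?_
          exact diag_conj_nonneg (posSemidef_hermFun _ fun t => Real.rpow_nonneg (abs_nonneg t) _)
            W _
      _ = _ := by
          rw [← Complex.re_sum]
          change (Wᴴ * hermFun (S ε) (fun t => |t| ^ p) * W).trace.re = _
          rw [trace_mul_comm, ← Matrix.mul_assoc, mul_eq_one_comm.mp hW, Matrix.one_mul]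
  have hc : (0 : ℝ) ≤ 1 / 2 ^ N := by positivity
  calc _ ≤ ∑ i, 2 ^ (s - 1) * (1 / 2 ^ N * ∑ ε, a ε i ^ s + η ^ s) := by
        refine Finset.sum_le_sum fun i _ => ?_
        refine (add_rpow_le hs (mul_nonneg hc (Finset.sum_nonneg fun ε _ => ha ε i)) hη).trans ?_
        gcongr
        exact average_rpow_le hs fun ε => ha ε i
    _ = 2 ^ (s - 1) * (1 / 2 ^ N * ∑ ε, ∑ i, a ε i ^ s + Fintype.card ι * η ^ s) := by
        rw [← Finset.mul_sum, Finset.sum_add_distrib, ← Finset.mul_sum, Finset.sum_comm]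
        simp
    _ ≤ _ := by
        gcongr with ε
        exact hsum ε

theorem re_trace_dilation_mul (x y : Matrix ι ι ℂ) :
    (dilation x * dilation y).trace.re = 2 * (x * yᴴ).trace.re := by
  have : (xᴴ * y).trace = star (x * yᴴ).trace := by
    rw [← trace_conjTranspose, conjTranspose_mul, conjTranspose_conjTranspose, trace_mul_comm]
  rw [dilation_mul, trace_fromBlocks_eq, this, Complex.add_re, Complex.star_def, Complex.conj_re,
    two_mul]

theorem trace_sylvester_mul {F₁ F₂ x y : Matrix ι ι ℂ} (h : F₁ * y + y * F₂ = x) :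
    (x * yᴴ).trace = (F₁ * (y * yᴴ)).trace + (F₂ * (yᴴ * y)).trace := by
  rw [← h, Matrix.add_mul, trace_add, Matrix.mul_assoc, trace_mul_cycle y, trace_mul_comm F₂]

variable [DecidableEq ι]

/-- Trace bound for a compression of an average of powers, shifted by a multiple of `1`. -/
theorem trace_posPow_compression_le {S : (Fin N → Bool) → Matrix κ κ ℂ}
    (hS : ∀ ε, (S ε).IsHermitian) {σ : ι → κ} (hσ : Function.Injective σ) {η p : ℝ} (hη : 0 ≤ η)
    (hp1 : 1 ≤ p) (hp2 : p < 2) {P : Matrix ι ι ℂ} (hP : P.PosSemidef)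
    (hW : ∀ U : Matrix ι ι ℂ, Uᴴ * U = 1 → ∃ W : Matrix κ κ ℂ, Wᴴ * W = 1 ∧ ∀ i,
      (Uᴴ * P * U) i i =
        (Wᴴ * (∑ ε, hermFun (S ε) (fun t => |t| ^ (2 - p))) * W) (σ i) (σ i)) :
    (posPow (((1 / 2 ^ N : ℝ) : ℂ) • P + (η : ℂ) • (1 : Matrix ι ι ℂ)) (p / (2 - p))).trace.re ≤
      2 ^ (p / (2 - p) - 1) * (1 / 2 ^ N * ∑ ε, (hermFun (S ε) (fun t => |t| ^ p)).trace.re +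
        Fintype.card ι * η ^ (p / (2 - p))) := by
  have hF : (((1 / 2 ^ N : ℝ) : ℂ) • P + (η : ℂ) • (1 : Matrix ι ι ℂ)).IsHermitian := by
    simp [IsHermitian, hP.1.eq]
  obtain ⟨U, d, hU, hFU, hf⟩ := exists_spectralForm hF
  obtain ⟨W, hWW, hWP⟩ := hW U hU
  rw [posPow_eq_hermFun, hf, trace_spectralForm hU, Complex.ofReal_re]
  have hd : ∀ i, d i = 1 / 2 ^ N *
      ∑ ε, ((Wᴴ * hermFun (S ε) (fun t => |t| ^ (2 - p)) * W) (σ i) (σ i)).re + η := by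
    intro i
    have h := conj_spectralForm_self_apply hU d i
    rw [← hFU, Matrix.mul_add, Matrix.add_mul, Matrix.mul_smul, Matrix.smul_mul, Matrix.mul_smul,
      Matrix.mul_one, Matrix.smul_mul, hU, Matrix.add_apply, Matrix.smul_apply, hWP,
      Finset.mul_sum, Finset.sum_mul, Matrix.sum_apply] at h
    have := congrArg Complex.re h
    rw [Complex.ofReal_re, Complex.add_re, smul_eq_mul, Complex.re_ofReal_mul, Complex.re_sum]
      at this
    rw [← this]
    simp
  simp only [hd]
  exact sum_rpow_average_diag_le hWW hS hσ hη hp1 hp2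

theorem trace_mul_dilation_sq {Φ : Matrix (ι ⊕ ι) (ι ⊕ ι) ℂ} (y : Matrix ι ι ℂ) :
    (Φ * (dilation y * dilation y)).trace =
      (Φ.toBlocks₁₁ * (y * yᴴ)).trace + (Φ.toBlocks₂₂ * (yᴴ * y)).trace := by
  conv_lhs => rw [dilation_mul, ← fromBlocks_toBlocks Φ]
  simp [fromBlocks_multiply, trace_fromBlocks_eq]

theorem tripleNorm_le_add {n : ℕ} {p η : ℝ} (hp1 : 1 < p) (hp2 : p < 2) (hη : 0 < η)
    (x : Fin N → Matrix (Fin n) (Fin n) ℂ) :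
    tripleNorm p x ≤ 2 * ((radAvg p x / (p - 1)) ^ (p / 2) *
      (2 ^ (p / (2 - p) - 1) * (2 * radAvg p x + n * η ^ (p / (2 - p)))) ^ (1 - p / 2)) ^
        (1 / p) := by
  set X : Fin N → Matrix (Fin n ⊕ Fin n) (Fin n ⊕ Fin n) ℂ := fun k => dilation (x k) with hX
  have hXH : ∀ k, (X k).IsHermitian := fun k => isHermitian_dilation _
  set Φ := ∑ ε, hermFun (signSum X ε) (fun t => |t| ^ (2 - p)) with hΦ
  have hΦ0 : Φ.PosSemidef := posSemidef_sum _ fun ε _ =>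
    posSemidef_hermFun _ fun t => Real.rpow_nonneg (abs_nonneg t) _
  have h11 : Φ.toBlocks₁₁.PosSemidef := hΦ0.submatrix Sum.inl
  have h22 : Φ.toBlocks₂₂.PosSemidef := hΦ0.submatrix Sum.inr
  set c : ℝ := 1 / 2 ^ N with hc_def
  have hc : 0 ≤ c := by positivity
  have hcN : 2 ^ N * c = 1 := by rw [hc_def]; field_simp
  have hsub : ∀ P : Matrix (Fin n) (Fin n) ℂ, P.PosSemidef →
      ((c : ℂ) • P + (η : ℂ) • (1 : Matrix (Fin n) (Fin n) ℂ) - (η : ℂ) • 1).PosSemidef := by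
    intro P hP
    rw [add_sub_cancel_right]
    exact hP.smul (by exact_mod_cast hc)
  have hpsd : ∀ P : Matrix (Fin n) (Fin n) ℂ, P.PosSemidef →
      ((c : ℂ) • P + (η : ℂ) • (1 : Matrix (Fin n) (Fin n) ℂ)).PosSemidef := fun P hP =>
    (hP.smul (by exact_mod_cast hc)).add (PosSemidef.one.smul (by exact_mod_cast hη.le))
  choose y hy using fun k => exists_sylvester hη (hsub _ h11) (hsub _ h22) (x k)
  set F₁ := (c : ℂ) • Φ.toBlocks₁₁ + (η : ℂ) • (1 : Matrix (Fin n) (Fin n) ℂ) with hF₁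
  set F₂ := (c : ℂ) • Φ.toBlocks₂₂ + (η : ℂ) • (1 : Matrix (Fin n) (Fin n) ℂ) with hF₂
  have hmain := sum_trace_abs_rpow_ge hp1 hp2 hXH (fun k => isHermitian_dilation (y k))
  rw [radAvg_eq_dilation (by linarith) x, ← hΦ] at hmain
  have hD₁ : ∀ k, c * (Φ.toBlocks₁₁ * (y k * (y k)ᴴ)).trace.re ≤
      (F₁ * (y k * (y k)ᴴ)).trace.re := by
    intro k
    have := (posSemidef_self_mul_conjTranspose (y k)).trace_nonneg
    have := (Complex.nonneg_iff.mp this).1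
    rw [hF₁, Matrix.add_mul, Matrix.smul_mul, Matrix.smul_mul, Matrix.one_mul, trace_add,
      trace_smul, trace_smul, Complex.add_re, smul_eq_mul, smul_eq_mul, Complex.re_ofReal_mul,
      Complex.re_ofReal_mul]
    nlinarith
  have hD₂ : ∀ k, c * (Φ.toBlocks₂₂ * ((y k)ᴴ * y k)).trace.re ≤
      (F₂ * ((y k)ᴴ * y k)).trace.re := by
    intro k
    have := (posSemidef_conjTranspose_mul_self (y k)).trace_nonneg
    have := (Complex.nonneg_iff.mp this).1
    rw [hF₂, Matrix.add_mul, Matrix.smul_mul, Matrix.smul_mul, Matrix.one_mul, trace_add,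
      trace_smul, trace_smul, Complex.add_re, smul_eq_mul, smul_eq_mul, Complex.re_ofReal_mul,
      Complex.re_ofReal_mul]
    nlinarith
  have hP₁ : ∀ k, 0 ≤ (F₁ * (y k * (y k)ᴴ)).trace.re := fun k =>
    trace_mul_nonneg (hpsd _ h11) (posSemidef_self_mul_conjTranspose (y k))
  have hP₂ : ∀ k, 0 ≤ (F₂ * ((y k)ᴴ * y k)).trace.re := fun k =>
    trace_mul_nonneg (hpsd _ h22) (posSemidef_conjTranspose_mul_self (y k))
  set l : Fin N → ℝ := fun k => (F₁ * (y k * (y k)ᴴ)).trace.re + (F₂ * ((y k)ᴴ * y k)).trace.re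
  have h1 : ∀ k, (X k * dilation (y k)).trace.re = 2 * l k := fun k => by
    rw [hX, re_trace_dilation_mul, trace_sylvester_mul (hy k), Complex.add_re]
  have h2 : c * ∑ k, (Φ * (dilation (y k) * dilation (y k))).trace.re ≤ ∑ k, l k := by
    rw [Finset.mul_sum]
    refine Finset.sum_le_sum fun k _ => ?_
    rw [trace_mul_dilation_sq, Complex.add_re, mul_add]
    exact add_le_add (hD₁ k) (hD₂ k)
  have hl : ∑ k, l k ≤ radAvg p x / (p - 1) := by
    rw [le_div_iff₀ (by linarith)]
    simp only [h1, ← Finset.mul_sum] at hmain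
    set Λ := ∑ k, l k
    set Z := ∑ k, (Φ * (dilation (y k) * dilation (y k))).trace.re
    have h3 := mul_le_mul_of_nonneg_left hmain hc
    have h4 : c * ((p - 1) * (2 * 2 ^ N * (2 * Λ) - 2 * Z)) =
        (p - 1) * (4 * (2 ^ N * c) * Λ - 2 * (c * Z)) := by ring
    have h5 : c * (2 * 2 ^ N * radAvg p x) = 2 * (2 ^ N * c) * radAvg p x := by ring
    rw [h4, h5, hcN] at h3
    nlinarith [mul_le_mul_of_nonneg_left h2 (sub_nonneg.mpr hp1.le)]
  have hS := isHermitian_signSum hXH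
  have hM : 1 / 2 ^ N * ∑ ε, (hermFun (signSum X ε) (fun t => |t| ^ p)).trace.re =
      2 * radAvg p x := by
    rw [radAvg_eq_dilation (by linarith) x]
    field_simp
  refine tripleNorm_le_of_sylvester hp1.le hp2 (hpsd _ h11) (hpsd _ h22) hy ?_ ?_ ?_ ?_
  · refine le_trans ?_ hl
    rw [Finset.mul_sum, trace_sum, Complex.re_sum]
    exact Finset.sum_le_sum fun k _ => le_add_of_nonneg_right (hP₂ k)
  · refine le_trans ?_ hl
    rw [Finset.mul_sum, trace_sum, Complex.re_sum]
    exact Finset.sum_le_sum fun k _ => le_add_of_nonneg_left (hP₁ k)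
  · have := trace_posPow_compression_le hS (σ := (Sum.inl : Fin n → Fin n ⊕ Fin n))
      Sum.inl_injective hη.le hp1.le hp2 h11 (fun U hU => ⟨fromBlocks U 0 0 1, by
        simp [fromBlocks_conjTranspose, fromBlocks_multiply, hU], fun i => by
        rw [← hΦ]
        conv_rhs => rw [← fromBlocks_toBlocks Φ]
        simp [fromBlocks_conjTranspose, fromBlocks_multiply]⟩)
    rwa [hM, Fintype.card_fin] at this
  · have := trace_posPow_compression_le hS (σ := (Sum.inr : Fin n → Fin n ⊕ Fin n))
      Sum.inr_injective hη.le hp1.le hp2 h22 (fun U hU => ⟨fromBlocks 1 0 0 U, by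
        simp [fromBlocks_conjTranspose, fromBlocks_multiply, hU], fun i => by
        rw [← hΦ]
        conv_rhs => rw [← fromBlocks_toBlocks Φ]
        simp [fromBlocks_conjTranspose, fromBlocks_multiply]⟩)
    rwa [hM, Fintype.card_fin] at this

/-- The noncommutative Khintchine inequality for `1 < p < 2`. -/
theorem tripleNorm_le_of_one_lt {n : ℕ} {p : ℝ} (hp1 : 1 < p) (hp2 : p < 2)
    (x : Fin N → Matrix (Fin n) (Fin n) ℂ) :
    tripleNorm p x ≤ 2 * ((1 / (p - 1)) ^ (p / 2) *
      (2 ^ (p / (2 - p) - 1) * 2) ^ (1 - p / 2)) ^ (1 / p) * radAvg p x ^ (1 / p) := by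
  set M := radAvg p x
  have hM : 0 ≤ M := radAvg_nonneg p x
  have hs : 0 < p / (2 - p) := div_pos (by linarith) (by linarith)
  have hcont : ContinuousAt (fun η : ℝ => 2 * ((M / (p - 1)) ^ (p / 2) *
      (2 ^ (p / (2 - p) - 1) * (2 * M + n * η ^ (p / (2 - p)))) ^ (1 - p / 2)) ^ (1 / p)) 0 := by
    have h1 : Continuous fun η : ℝ => η ^ (p / (2 - p)) :=
      Real.continuous_rpow_const hs.le
    have h2 : Continuous fun η : ℝ => η ^ (1 - p / 2) :=
      Real.continuous_rpow_const (by linarith)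
    have h3 : Continuous fun η : ℝ => η ^ (1 / p) :=
      Real.continuous_rpow_const (by positivity)
    exact (continuous_const.mul (h3.comp (continuous_const.mul (h2.comp (continuous_const.mul
      (continuous_const.add (continuous_const.mul h1))))))).continuousAt
  have h := ge_of_tendsto (hcont.tendsto.mono_left (nhdsWithin_le_nhds (s := Set.Ioi 0)))
    (Filter.eventually_of_mem self_mem_nhdsWithin fun η hη => tripleNorm_le_add hp1 hp2 hη x)
  refine h.trans_eq ?_
  have hp0 : 0 < p - 1 := by linarith
  have e1 : M ^ (p / 2) * M ^ (1 - p / 2) = M := by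
    rw [← Real.rpow_add' hM (by norm_num), add_sub_cancel, Real.rpow_one]
  have e2 : (M * (1 / (p - 1))) ^ (p / 2) * (2 ^ (p / (2 - p) - 1) * 2 * M) ^ (1 - p / 2) =
      (1 / (p - 1)) ^ (p / 2) * (2 ^ (p / (2 - p) - 1) * 2) ^ (1 - p / 2) * M := by
    rw [Real.mul_rpow hM (by positivity),
      Real.mul_rpow (x := 2 ^ (p / (2 - p) - 1) * 2) (y := M) (by positivity) hM]
    linear_combination
      (1 / (p - 1)) ^ (p / 2) * (2 ^ (p / (2 - p) - 1) * 2 : ℝ) ^ (1 - p / 2) * e1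
  rw [Real.zero_rpow hs.ne', mul_zero, add_zero, ← mul_assoc (2 ^ _) 2 M, div_eq_mul_one_div M,
    e2, Real.mul_rpow (by positivity) hM, ← mul_assoc]

end OneLt

section FourthMoment

variable {ι : Type*} {N : ℕ}

/-- The average over all sign vectors. -/
noncomputable def signMean (f : (Fin N → Bool) → Matrix ι ι ℂ) : Matrix ι ι ℂ :=
  ((1 / 2 ^ N : ℝ) : ℂ) • ∑ ε, f ε

theorem signMean_add (f g : (Fin N → Bool) → Matrix ι ι ℂ) :
    signMean (fun ε => f ε + g ε) = signMean f + signMean g := by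
  simp only [signMean, Finset.sum_add_distrib, smul_add]

theorem signMean_sub (f g : (Fin N → Bool) → Matrix ι ι ℂ) :
    signMean (fun ε => f ε - g ε) = signMean f - signMean g := by
  simp only [signMean, Finset.sum_sub_distrib, smul_sub]

theorem signMean_const (A : Matrix ι ι ℂ) : signMean (fun _ : Fin N → Bool => A) = A := by
  simp only [signMean, Finset.sum_const, Finset.card_univ, Fintype.card_fun, Fintype.card_bool,
    Fintype.card_fin, ← Nat.cast_smul_eq_nsmul ℂ, smul_smul]
  simp

theorem signMean_sum {κ : Type*} (s : Finset κ) (f : κ → (Fin N → Bool) → Matrix ι ι ℂ) :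
    signMean (fun ε => ∑ k ∈ s, f k ε) = ∑ k ∈ s, signMean (f k) := by
  simp only [signMean, Finset.sum_comm (t := s), Finset.smul_sum]

theorem signMean_succ (f : (Fin (N + 1) → Bool) → Matrix ι ι ℂ) :
    signMean f = signMean (fun ε : Fin N → Bool =>
      (1 / 2 : ℂ) • (f (Fin.cons true ε) + f (Fin.cons false ε))) := by
  have h : ∑ ε, f ε = ∑ ε : Fin N → Bool, (f (Fin.cons true ε) + f (Fin.cons false ε)) := by
    rw [← (Fin.consEquiv (fun _ => Bool)).sum_comp, Fintype.sum_prod_type, Fintype.sum_bool,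
      ← Finset.sum_add_distrib]
    rfl
  rw [signMean, signMean, h, ← Finset.smul_sum, smul_smul]
  congr 1
  push_cast
  rw [pow_succ]
  field_simp

theorem signSum_cons (x : Fin (N + 1) → Matrix ι ι ℂ) (b : Bool) (ε : Fin N → Bool) :
    signSum x (Fin.cons b ε) =
      (if b then (1 : ℂ) else -1) • x 0 + signSum (fun k => x k.succ) ε := by
  simp [signSum, Fin.sum_univ_succ]

theorem posSemidef_signMean {f : (Fin N → Bool) → Matrix ι ι ℂ} (hf : ∀ ε, (f ε).PosSemidef) :
    (signMean f).PosSemidef :=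
  (posSemidef_sum _ fun ε _ => hf ε).smul (by exact_mod_cast (by positivity : (0:ℝ) ≤ 1 / 2 ^ N))

variable [Fintype ι]

theorem signMean_mul_left (A : Matrix ι ι ℂ) (f : (Fin N → Bool) → Matrix ι ι ℂ) :
    signMean (fun ε => A * f ε) = A * signMean f := by
  simp only [signMean, ← Finset.mul_sum, Matrix.mul_smul]

theorem signMean_mul_right (A : Matrix ι ι ℂ) (f : (Fin N → Bool) → Matrix ι ι ℂ) :
    signMean (fun ε => f ε * A) = signMean f * A := by
  simp only [signMean, ← Finset.sum_mul, Matrix.smul_mul]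

theorem signMean_conj (x : Fin N → Matrix ι ι ℂ) (B : Matrix ι ι ℂ) :
    signMean (fun ε => signSum x ε * B * signSum x ε) = ∑ k, x k * B * x k := by
  induction N with
  | zero => simp [signMean, signSum]
  | succ N ih =>
    rw [signMean_succ, Fin.sum_univ_succ, ← ih fun k => x k.succ,
      ← signMean_const (N := N) (x 0 * B * x 0), ← signMean_add]
    congr 1
    ext1 ε
    rw [signSum_cons, signSum_cons]
    simp only [if_true, if_false, one_smul, neg_smul, Bool.false_eq_true]
    generalize signSum (fun k => x k.succ) ε = G
    rw [show (x 0 + G) * B * (x 0 + G) + (-x 0 + G) * B * (-x 0 + G) =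
      (2 : ℂ) • (x 0 * B * x 0 + G * B * G) by rw [two_smul]; noncomm_ring, smul_smul]
    norm_num

theorem posSemidef_fourthMoment {x : Fin N → Matrix ι ι ℂ} (hx : ∀ k, (x k).IsHermitian) :
    ((∑ k, x k * x k) * (∑ k, x k * x k) + (2 : ℂ) • ∑ k, x k * (∑ k, x k * x k) * x k -
      signMean (fun ε => signSum x ε * signSum x ε * (signSum x ε * signSum x ε))).PosSemidef := by
  classical
  induction N with
  | zero => simpa [signMean, signSum] using PosSemidef.zero
  | succ N ih =>
    set y : Fin N → Matrix ι ι ℂ := fun k => x k.succ with hy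
    set A := x 0 with hA
    have hyH : ∀ k, (y k).IsHermitian := fun k => hx _
    set K := ∑ k, y k * y k with hK
    have hK1 : signMean (fun ε => signSum y ε * signSum y ε) = K := by
      simpa using signMean_conj y 1
    have hsum : signMean (fun ε => signSum x ε * signSum x ε * (signSum x ε * signSum x ε)) +
        signMean (fun ε => (signSum y ε * A - A * signSum y ε)ᴴ *
          (signSum y ε * A - A * signSum y ε)) =
        A * A * (A * A) + signMean (fun ε => signSum y ε * signSum y ε *
          (signSum y ε * signSum y ε)) + A * A * K + K * (A * A) + (2 : ℂ) • (A * K * A) +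
          (2 : ℂ) • ∑ k, y k * (A * A) * y k := by
      rw [signMean_succ, ← signMean_add, ← hK1, ← signMean_conj, ← signMean_mul_left,
        ← signMean_mul_left, ← signMean_mul_right, ← signMean_mul_right, two_smul, two_smul,
        ← signMean_const (N := N) (A * A * (A * A))]
      simp only [← signMean_add]
      congr 1
      ext1 ε
      rw [signSum_cons, signSum_cons, conjTranspose_sub, conjTranspose_mul, conjTranspose_mul,
        (isHermitian_signSum hyH ε).eq, (hx 0).eq]
      simp only [if_true, if_false, one_smul, neg_smul, Bool.false_eq_true, ← hA, ← hy]
      generalize signSum y ε = G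
      rw [show (A + G) * (A + G) * ((A + G) * (A + G)) + (-A + G) * (-A + G) *
        ((-A + G) * (-A + G)) = (2 : ℂ) • (A * A * (A * A) + G * G * (G * G) + A * A * (G * G) +
          G * G * (A * A) + A * (G * G) * A + G * (A * A) * G + A * G * A * G + G * A * G * A) by
          rw [two_smul]; noncomm_ring, smul_smul]
      norm_num
      noncomm_ring
    have hQ : (signMean (fun ε => (signSum y ε * A - A * signSum y ε)ᴴ *
          (signSum y ε * A - A * signSum y ε))).PosSemidef :=
      posSemidef_signMean fun ε => posSemidef_conjTranspose_mul_self _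
    have hA4 : (A * A * (A * A)).PosSemidef := by
      have := posSemidef_conjTranspose_mul_self (A * A)
      rwa [conjTranspose_mul, (hx 0).eq] at this
    have := ((ih hyH).add (hA4.add hA4)).add hQ
    convert this using 1
    rw [← eq_sub_iff_add_eq] at hsum
    rw [hsum, Fin.sum_univ_succ, Fin.sum_univ_succ, ← hA]
    change (A * A + K) * (A * A + K) + (2 : ℂ) • (A * (A * A + K) * A + ∑ k, y k * (A * A + K) * y k)
      - _ = _
    simp only [two_smul, Matrix.mul_add, Matrix.add_mul, Finset.sum_add_distrib]
    noncomm_ring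

end FourthMoment

section Truncation

variable {ι : Type*} {N : ℕ}

/-- The first order Walsh coefficient of a matrix valued function of the signs. -/
noncomputable def signCoeff (Z : (Fin N → Bool) → Matrix ι ι ℂ) (k : Fin N) : Matrix ι ι ℂ :=
  signMean fun ε => (if ε k then (1 : ℂ) else -1) • Z ε

theorem isHermitian_signMean {Z : (Fin N → Bool) → Matrix ι ι ℂ} (hZ : ∀ ε, (Z ε).IsHermitian) :
    (signMean Z).IsHermitian := by
  rw [IsHermitian, signMean, conjTranspose_smul, conjTranspose_sum]
  simp only [(hZ _).eq, Complex.star_def, Complex.conj_ofReal]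

theorem isHermitian_signCoeff {Z : (Fin N → Bool) → Matrix ι ι ℂ} (hZ : ∀ ε, (Z ε).IsHermitian)
    (k : Fin N) : (signCoeff Z k).IsHermitian := by
  refine isHermitian_signMean fun ε => ?_
  cases ε k <;> simpa using hZ ε

theorem signCoeff_signSum (y : Fin N → Matrix ι ι ℂ) (k : Fin N) :
    signCoeff (signSum y) k = y k := by
  set s : (Fin N → Bool) → ℂ := fun ε => if ε k then 1 else -1 with hs
  have hflip : ∀ ε, s (flipSign k ε) = -s ε := fun ε => by
    cases h : ε k <;> simp [hs, flipSign, h]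
  have hsq : ∀ ε, s ε * s ε = 1 := fun ε => by cases h : ε k <;> simp [hs, h]
  have key : (2 : ℂ) • ∑ ε, s ε • signSum y ε = (2 : ℂ) • ∑ _ε : Fin N → Bool, y k := by
    calc (2 : ℂ) • ∑ ε, s ε • signSum y ε
        = ∑ ε, s ε • signSum y ε + ∑ ε, s (flipSign k ε) • signSum y (flipSign k ε) := by
          rw [two_smul, sum_flipSign k fun ε => s ε • signSum y ε]
      _ = ∑ ε, s ε • (signSum y ε - signSum y (flipSign k ε)) := by
          rw [← Finset.sum_add_distrib]
          refine Finset.sum_congr rfl fun ε _ => ?_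
          rw [hflip, neg_smul, smul_sub, sub_eq_add_neg]
      _ = (2 : ℂ) • ∑ _ε : Fin N → Bool, y k := by
          rw [Finset.smul_sum]
          refine Finset.sum_congr rfl fun ε _ => ?_
          rw [signSum_sub_flipSign, smul_comm, ← mul_smul (s ε), hsq, one_smul]
  have key' := smul_right_injective _ (two_ne_zero' ℂ) key
  rw [signCoeff, signMean, key']
  exact signMean_const (y k)

variable [Fintype ι]

theorem signMean_mul_signSum (Z : (Fin N → Bool) → Matrix ι ι ℂ) (y : Fin N → Matrix ι ι ℂ) :
    signMean (fun ε => Z ε * signSum y ε) = ∑ k, signCoeff Z k * y k := by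
  simp only [signSum, Matrix.mul_sum, signMean_sum, signCoeff, ← signMean_mul_right,
    Matrix.mul_smul, Matrix.smul_mul]

theorem signMean_signSum_mul (Z : (Fin N → Bool) → Matrix ι ι ℂ) (y : Fin N → Matrix ι ι ℂ) :
    signMean (fun ε => signSum y ε * Z ε) = ∑ k, y k * signCoeff Z k := by
  simp only [signSum, Matrix.sum_mul, signMean_sum, signCoeff, ← signMean_mul_left,
    Matrix.mul_smul, Matrix.smul_mul]

variable [DecidableEq ι]

theorem posSemidef_sub_mul_self {C : Matrix ι ι ℂ} (hC : C.PosSemidef)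
    (h1 : (1 - C).PosSemidef) : (C - C * C).PosSemidef := by
  have := (h1.conjTranspose_mul_mul_same C).add (hC.conjTranspose_mul_mul_same (1 - C))
  rw [hC.1.eq, h1.1.eq] at this
  convert this using 1
  noncomm_ring

/-- The fourth moment of a Rademacher sum of Hermitian matrices with variance at most `1`. -/
theorem posSemidef_three_sub_fourthMoment {x : Fin N → Matrix ι ι ℂ}
    (hx : ∀ k, (x k).IsHermitian) (h : (1 - ∑ k, x k * x k).PosSemidef) :
    ((3 : ℂ) • (1 : Matrix ι ι ℂ) -
      signMean (fun ε => signSum x ε * signSum x ε * (signSum x ε * signSum x ε))).PosSemidef := by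
  have hC : (∑ k, x k * x k).PosSemidef := posSemidef_sum _ fun k _ => by
    simpa only [(hx k).eq] using posSemidef_conjTranspose_mul_self (x k)
  have hD : (∑ k, x k * (1 - ∑ k, x k * x k) * x k).PosSemidef := posSemidef_sum _ fun k _ => by
    simpa only [(hx k).eq] using h.conjTranspose_mul_mul_same (x k)
  have := ((((h.add h).add h).add (posSemidef_sub_mul_self hC h)).add (hD.add hD)).add
    (posSemidef_fourthMoment hx)
  convert this using 1
  simp only [Matrix.mul_sub, Matrix.sub_mul, Finset.sum_sub_distrib, Matrix.mul_one]
  rw [show (3 : ℂ) = 1 + 1 + 1 by norm_num, add_smul, add_smul, one_smul, two_smul]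
  abel

/-- Bessel's inequality for the first order Walsh coefficients. -/
theorem posSemidef_signMean_sub_signCoeff {Z : (Fin N → Bool) → Matrix ι ι ℂ}
    (hZ : ∀ ε, (Z ε).IsHermitian) :
    (signMean (fun ε => Z ε * Z ε) - ∑ k, signCoeff Z k * signCoeff Z k).PosSemidef := by
  have h : (signMean fun ε => (Z ε - signSum (signCoeff Z) ε) *
      (Z ε - signSum (signCoeff Z) ε)).PosSemidef := posSemidef_signMean fun ε => by
    simpa only [((hZ ε).sub (isHermitian_signSum (isHermitian_signCoeff hZ) ε)).eq] using
      posSemidef_conjTranspose_mul_self (Z ε - signSum (signCoeff Z) ε)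
  convert h using 1
  have h1 : signMean (fun ε => signSum (signCoeff Z) ε * signSum (signCoeff Z) ε) =
      ∑ k, signCoeff Z k * signCoeff Z k := by
    simpa using signMean_conj (signCoeff Z) 1
  simp only [Matrix.mul_sub, Matrix.sub_mul, signMean_sub, signMean_mul_signSum,
    signMean_signSum_mul, h1]
  abel

theorem hermFun_sub (A : Matrix ι ι ℂ) (f g : ℝ → ℝ) :
    hermFun A (fun t => f t - g t) = hermFun A f - hermFun A g := by
  by_cases hA : A.IsHermitian
  · obtain ⟨U, d, -, -, h⟩ := exists_spectralForm hA
    rw [h, h, h, eq_sub_iff_add_eq, spectralForm_add]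
    simp
  · simp [hermFun, hA]

theorem hermFun_add (A : Matrix ι ι ℂ) (f g : ℝ → ℝ) :
    hermFun A (fun t => f t + g t) = hermFun A f + hermFun A g := by
  by_cases hA : A.IsHermitian
  · obtain ⟨U, d, -, -, h⟩ := exists_spectralForm hA
    rw [h, h, h, spectralForm_add]
  · simp [hermFun, hA]

theorem hermFun_id {A : Matrix ι ι ℂ} (hA : A.IsHermitian) : hermFun A (fun t => t) = A := by
  obtain ⟨U, d, -, h', h⟩ := exists_spectralForm hA
  rw [h, ← h']

theorem hermFun_const_one {A : Matrix ι ι ℂ} (hA : A.IsHermitian) :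
    hermFun A (fun _ => 1) = 1 := by
  obtain ⟨U, d, hU, -, h⟩ := exists_spectralForm hA
  rw [h, spectralForm_one hU]

theorem hermFun_mul {A : Matrix ι ι ℂ} (f g : ℝ → ℝ) :
    hermFun A f * hermFun A g = hermFun A (fun t => f t * g t) := by
  by_cases hA : A.IsHermitian
  · obtain ⟨U, d, hU, -, h⟩ := exists_spectralForm hA
    rw [h, h, h, spectralForm_mul hU]
  · simp [hermFun, hA]

theorem posSemidef_hermFun_sub (A : Matrix ι ι ℂ) {f g : ℝ → ℝ} (h : ∀ t, g t ≤ f t) :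
    (hermFun A f - hermFun A g).PosSemidef := by
  rw [← hermFun_sub]
  exact posSemidef_hermFun A fun t => sub_nonneg.2 (h t)

/-- Duality between the trace norm and the operator norm for Hermitian matrices. -/
theorem trace_mul_hermFun_le {S G : Matrix ι ι ℂ} (hS : S.IsHermitian) (hG : G.IsHermitian)
    {f : ℝ → ℝ} (hf : ∀ t, |f t| ≤ 1) :
    (S * hermFun G f).trace.re ≤ (hermFun S (fun t => |t|)).trace.re := by
  have h1 : (1 - hermFun G f).PosSemidef := by
    rw [← hermFun_const_one hG]
    exact posSemidef_hermFun_sub G fun t => (abs_le.1 (hf t)).2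
  have h2 : (1 + hermFun G f).PosSemidef := by
    have := posSemidef_hermFun_sub G (f := f) (g := fun t => 0 - 1) fun t => by
      linarith [(abs_le.1 (hf t)).1]
    rw [hermFun_sub G (fun _ => 0) (fun _ => 1), hermFun_const_one hG] at this
    have h0 : hermFun G (fun _ => 0) = 0 := by
      simpa using hermFun_sub G (fun t => 0) (fun t => 0)
    rw [h0] at this
    convert this using 1
    abel
  have k1 := trace_mul_nonneg (posSemidef_hermFun S (f := fun t => max t 0)
    fun t => le_max_right _ _) h1
  have k2 := trace_mul_nonneg (posSemidef_hermFun S (f := fun t => max t 0 - t)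
    fun t => sub_nonneg.2 (le_max_left _ _)) h2
  have e1 : hermFun S (fun t => max t 0) - hermFun S (fun t => max t 0 - t) = S := by
    rw [← hermFun_sub]
    simpa using hermFun_id hS
  have e2 : hermFun S (fun t => |t|) =
      hermFun S (fun t => max t 0) + hermFun S (fun t => max t 0 - t) := by
    rw [← sub_eq_iff_eq_add, ← hermFun_sub]
    congr 1
    ext t
    rcases le_total 0 t with h | h <;> simp [h, abs_of_nonneg, abs_of_nonpos]
  rw [e2]
  conv_lhs => rw [← e1]
  simp only [Matrix.mul_sub, Matrix.sub_mul, Matrix.mul_add, Matrix.mul_one, trace_sub, trace_add,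
    Complex.sub_re, Complex.add_re] at *
  linarith

theorem posSemidef_ofReal_smul {κ : Type*} {A : Matrix κ κ ℂ} (hA : A.PosSemidef) {c : ℝ}
    (hc : 0 ≤ c) : ((c : ℂ) • A).PosSemidef :=
  hA.smul (by exact_mod_cast hc)

/-- One step of the truncation argument for Rademacher sums of Hermitian matrices. -/
theorem exists_truncation {A : Fin N → Matrix ι ι ℂ} (hA : ∀ k, (A k).IsHermitian)
    (h : (1 - ∑ k, A k * A k).PosSemidef) :
    ∃ w : Fin N → Matrix ι ι ℂ, (∀ k, (w k).IsHermitian) ∧ (1 - ∑ k, w k * w k).PosSemidef ∧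
      ∀ x : Fin N → Matrix ι ι ℂ, (∀ k, (x k).IsHermitian) →
        ∑ k, (x k * A k).trace.re ≤
          1 / 2 ^ N * ∑ ε, (hermFun (signSum x ε) (fun t => |t|)).trace.re +
            1 / 2 * ∑ k, (x k * w k).trace.re := by
  set f : ℝ → ℝ := fun t => 4 * t / (4 + t * t) with hf
  set g : ℝ → ℝ := fun t => 2 * (t - f t) with hg
  have hpos : ∀ t : ℝ, 0 < 4 + t * t := fun t => by nlinarith [mul_self_nonneg t]
  have hf1 : ∀ t, |f t| ≤ 1 := fun t => by
    rw [abs_le, hf, le_div_iff₀ (hpos t), div_le_iff₀ (hpos t)]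
    constructor <;> nlinarith [mul_self_nonneg (t - 2), mul_self_nonneg (t + 2)]
  have hg1 : ∀ t, g t * g t + g t * g t + g t * g t + g t * g t ≤ t * t * (t * t) := fun t => by
    have e : g t = 2 * t * (t * t) / (4 + t * t) := by
      rw [hg, hf, eq_div_iff (hpos t).ne']
      have := (hpos t).ne'
      field_simp
      ring
    rw [e, show ∀ a : ℝ, a * a + a * a + a * a + a * a = (2 * a) ^ 2 from fun a => by ring,
      mul_div_assoc', div_pow, div_le_iff₀ (pow_pos (hpos t) 2)]
    nlinarith [mul_nonneg (sq_nonneg (t ^ 2)) (sq_nonneg (t ^ 2 - 4))]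
  have hG := isHermitian_signSum hA
  set Z : (Fin N → Bool) → Matrix ι ι ℂ := fun ε => hermFun (signSum A ε) g with hZ
  have hZH : ∀ ε, (Z ε).IsHermitian := fun ε => isHermitian_hermFun _ _
  refine ⟨signCoeff Z, isHermitian_signCoeff hZH, ?_, fun x hx => ?_⟩
  · have h4 : (signMean (fun ε => signSum A ε * signSum A ε * (signSum A ε * signSum A ε) -
        (Z ε * Z ε + Z ε * Z ε + Z ε * Z ε + Z ε * Z ε))).PosSemidef := by
      refine posSemidef_signMean fun ε => ?_
      have := posSemidef_hermFun_sub (signSum A ε) hg1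
      simpa only [hermFun_add, ← hermFun_mul, hermFun_id (hG ε)] using this
    have hB := posSemidef_signMean_sub_signCoeff hZH
    have := posSemidef_ofReal_smul ((((((posSemidef_three_sub_fourthMoment hA h).add h4).add
      hB).add hB).add hB).add hB |>.add PosSemidef.one) (c := 1 / 4) (by norm_num)
    convert this using 1
    have e4 : ∀ B : Matrix ι ι ℂ, (4 : ℂ) • B = B + B + B + B := fun B => by
      rw [show (4 : ℂ) = 1 + 1 + 1 + 1 by norm_num, add_smul, add_smul, add_smul, one_smul]
    rw [signMean_sub, signMean_add, signMean_add, signMean_add,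
      show (3 : ℂ) = 4 - 1 by norm_num, sub_smul, one_smul,
      show ((1 / 4 : ℝ) : ℂ) = (4 : ℂ)⁻¹ by norm_num, eq_inv_smul_iff₀ (by norm_num), smul_sub,
      e4 (∑ k, _)]
    abel
  · have e1 : ∀ Y : (Fin N → Bool) → Matrix ι ι ℂ, ∑ k, (x k * signCoeff Y k).trace.re =
        1 / 2 ^ N * ∑ ε, (signSum x ε * Y ε).trace.re := fun Y => by
      rw [← Complex.re_sum, ← trace_sum, ← signMean_signSum_mul, signMean, trace_smul, trace_sum,
        smul_eq_mul, Complex.re_ofReal_mul, Complex.re_sum]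
    have e2 : ∀ ε, signSum A ε = hermFun (signSum A ε) f + ((1 / 2 : ℝ) : ℂ) • Z ε := fun ε => by
      have : Z ε = hermFun (signSum A ε) (fun t => t - f t) +
          hermFun (signSum A ε) (fun t => t - f t) := by
        rw [← hermFun_add]
        exact congrArg (hermFun (signSum A ε)) (funext fun t => two_mul (t - f t))
      rw [this, ← two_smul ℂ, smul_smul, hermFun_sub, hermFun_id (hG ε)]
      norm_num
    rw [e1 Z]
    simp only [← signCoeff_signSum A]
    rw [e1, mul_left_comm, ← mul_add]
    refine mul_le_mul_of_nonneg_left ?_ (by positivity)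
    rw [Finset.mul_sum, ← Finset.sum_add_distrib]
    refine Finset.sum_le_sum fun ε _ => ?_
    rw [e2 ε, Matrix.mul_add, Matrix.mul_smul, trace_add, trace_smul, smul_eq_mul, Complex.add_re,
      Complex.re_ofReal_mul]
    refine add_le_add_left ?_ _
    exact trace_mul_hermFun_le (isHermitian_signSum hx ε) (hG ε) hf1

end Truncation

section Duality

variable {ι : Type*} {N : ℕ}

theorem posSemidef_toBlocks₁₁ {A : Matrix (ι ⊕ ι) (ι ⊕ ι) ℂ} (hA : A.PosSemidef) :
    A.toBlocks₁₁.PosSemidef := hA.submatrix Sum.inl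

theorem posSemidef_toBlocks₂₂ {A : Matrix (ι ⊕ ι) (ι ⊕ ι) ℂ} (hA : A.PosSemidef) :
    A.toBlocks₂₂.PosSemidef := hA.submatrix Sum.inr

theorem toBlocks_of_isHermitian {A : Matrix (ι ⊕ ι) (ι ⊕ ι) ℂ} (hA : A.IsHermitian) :
    A.toBlocks₁₁ᴴ = A.toBlocks₁₁ ∧ A.toBlocks₂₁ = A.toBlocks₁₂ᴴ ∧
      A.toBlocks₂₂ᴴ = A.toBlocks₂₂ := by
  refine ⟨?_, ?_, ?_⟩ <;> ext i j
  · exact hA.apply _ _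
  · exact (hA.apply _ _).symm
  · exact hA.apply _ _

variable [Fintype ι]

theorem re_trace_mul_eq {n : Type*} [Fintype n] (x y : Matrix n n ℂ) :
    (xᴴ * y).trace.re = (x * yᴴ).trace.re := by
  rw [← Complex.conj_re, ← Complex.star_def, ← trace_conjTranspose, conjTranspose_mul,
    conjTranspose_conjTranspose, trace_mul_comm]

theorem two_mul_re_trace_le (x v : Matrix ι ι ℂ) :
    2 * (x * vᴴ).trace.re ≤ (x * xᴴ).trace.re + (v * vᴴ).trace.re := by
  have h : 0 ≤ ((x - v) * (x - v)ᴴ).trace.re :=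
    (Complex.nonneg_iff.mp (posSemidef_self_mul_conjTranspose (x - v)).trace_nonneg).1
  rw [conjTranspose_sub, Matrix.sub_mul, Matrix.mul_sub, Matrix.mul_sub] at h
  simp only [trace_sub, Complex.sub_re] at h
  have : (v * xᴴ).trace.re = (x * vᴴ).trace.re := by rw [← re_trace_mul_eq, trace_mul_comm]
  linarith

variable [DecidableEq ι]

open scoped MatrixOrder Matrix.Norms.L2Operator in
theorem posSemidef_fromBlocks_diagonal {A B : Matrix ι ι ℂ} (hA : A.PosSemidef)
    (hB : B.PosSemidef) : (fromBlocks A 0 0 B).PosSemidef := by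
  obtain ⟨S, rfl⟩ := CStarAlgebra.nonneg_iff_eq_star_mul_self.mp hA.nonneg
  obtain ⟨T, rfl⟩ := CStarAlgebra.nonneg_iff_eq_star_mul_self.mp hB.nonneg
  have := posSemidef_conjTranspose_mul_self (fromBlocks S 0 0 T)
  rw [fromBlocks_conjTranspose, fromBlocks_multiply] at this
  simpa [star_eq_conjTranspose] using this

/-- The unit ball dual to the norm `|||·|||₁`, up to constants. -/
def rowColBall (v : Fin N → Matrix ι ι ℂ) : Prop :=
  (1 - ∑ k, (v k)ᴴ * v k).PosSemidef ∧ (1 - ∑ k, v k * (v k)ᴴ).PosSemidef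

theorem rowColBall_toBlocks₁₂ {w : Fin N → Matrix (ι ⊕ ι) (ι ⊕ ι) ℂ}
    (hw : ∀ k, (w k).IsHermitian) (h : (1 - ∑ k, w k * w k).PosSemidef) :
    rowColBall fun k => (w k).toBlocks₁₂ := by
  have e : ∀ k, w k * w k = fromBlocks
      (((w k).toBlocks₁₁)ᴴ * (w k).toBlocks₁₁ + (w k).toBlocks₁₂ * ((w k).toBlocks₁₂)ᴴ)
      ((w k * w k).toBlocks₁₂) ((w k * w k).toBlocks₂₁)
      (((w k).toBlocks₁₂)ᴴ * (w k).toBlocks₁₂ + ((w k).toBlocks₂₂)ᴴ * (w k).toBlocks₂₂) := by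
    intro k
    obtain ⟨h1, h2, h3⟩ := toBlocks_of_isHermitian (hw k)
    rw [h1, h3, ← h2]
    conv_lhs => rw [← fromBlocks_toBlocks (w k * w k)]
    congr 1
    · conv_lhs => rw [← fromBlocks_toBlocks (w k), fromBlocks_multiply, toBlocks_fromBlocks₁₁]
    · conv_lhs => rw [← fromBlocks_toBlocks (w k), fromBlocks_multiply, toBlocks_fromBlocks₂₂]
  constructor
  · have := (posSemidef_toBlocks₂₂ h).add (posSemidef_sum Finset.univ fun k _ =>
      posSemidef_conjTranspose_mul_self (w k).toBlocks₂₂)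
    convert this using 1
    rw [Finset.sum_congr rfl fun k _ => e k]
    ext i j
    simp [toBlocks₂₂, Matrix.sum_apply, Finset.sum_add_distrib, one_apply]
    ring
  · have := (posSemidef_toBlocks₁₁ h).add (posSemidef_sum Finset.univ fun k _ =>
      posSemidef_conjTranspose_mul_self (w k).toBlocks₁₁)
    convert this using 1
    rw [Finset.sum_congr rfl fun k _ => e k]
    ext i j
    simp [toBlocks₁₁, Matrix.sum_apply, Finset.sum_add_distrib, one_apply]
    ring

theorem re_trace_dilation_mul_toBlocks (x : Matrix ι ι ℂ) {w : Matrix (ι ⊕ ι) (ι ⊕ ι) ℂ}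
    (hw : w.IsHermitian) : (dilation x * w).trace.re = 2 * (x * (w.toBlocks₁₂)ᴴ).trace.re := by
  conv_lhs => rw [dilation, ← fromBlocks_toBlocks w, (toBlocks_of_isHermitian hw).2.1,
    fromBlocks_multiply, trace_fromBlocks_eq]
  simp [re_trace_mul_eq, two_mul]

theorem exists_rowColBall {n : ℕ} (x : Fin N → Matrix (Fin n) (Fin n) ℂ)
    {v : Fin N → Matrix (Fin n) (Fin n) ℂ} (hv : rowColBall v) :
    ∃ w, rowColBall w ∧ ∑ k, (x k * (v k)ᴴ).trace.re ≤
      radAvg 1 x + 1 / 2 * ∑ k, (x k * (w k)ᴴ).trace.re := by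
  have h : (1 - ∑ k, dilation (v k) * dilation (v k)).PosSemidef := by
    convert posSemidef_fromBlocks_diagonal hv.2 hv.1 using 1
    simp only [dilation_mul]
    ext i j
    rcases i with i | i <;> rcases j with j | j <;> simp [Matrix.sum_apply, one_apply]
  obtain ⟨w, hw, hw1, hx⟩ := exists_truncation (fun k => isHermitian_dilation (v k)) h
  refine ⟨_, rowColBall_toBlocks₁₂ hw hw1, ?_⟩
  have := hx (fun k => dilation (x k)) fun k => isHermitian_dilation (x k)
  have hr := radAvg_eq_dilation one_ne_zero x
  simp only [Real.rpow_one] at hr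
  rw [hr] at this
  simp only [re_trace_dilation_mul_toBlocks _ (hw _), re_trace_dilation_mul, ← Finset.mul_sum]
    at this
  rw [show 1 / 2 ^ N * (2 * 2 ^ N * radAvg 1 x) = 2 * radAvg 1 x by field_simp] at this
  linarith

theorem sum_re_trace_le_of_rowColBall {n : ℕ} (x : Fin N → Matrix (Fin n) (Fin n) ℂ)
    {v : Fin N → Matrix (Fin n) (Fin n) ℂ} (hv : rowColBall v) :
    ∑ k, (x k * (v k)ᴴ).trace.re ≤ 2 * radAvg 1 x := by
  set R : ℝ := |∑ k, (x k * (x k)ᴴ).trace.re| + n with hR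
  have key : ∀ m : ℕ, ∀ v : Fin N → Matrix (Fin n) (Fin n) ℂ, rowColBall v →
      ∑ k, (x k * (v k)ᴴ).trace.re ≤ 2 * radAvg 1 x + R * (1 / 2) ^ m := by
    intro m
    induction m with
    | zero =>
      intro v hv
      have h1 := Finset.sum_le_sum fun k (_ : k ∈ Finset.univ) => two_mul_re_trace_le (x k) (v k)
      rw [Finset.sum_add_distrib, ← Finset.mul_sum] at h1
      have h2 := (Complex.nonneg_iff.mp hv.2.trace_nonneg).1
      rw [trace_sub, trace_one, Complex.sub_re, trace_sum, Complex.re_sum] at h2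
      simp at h2
      have := le_abs_self (∑ k, (x k * (x k)ᴴ).trace.re)
      have h0 := radAvg_nonneg 1 x
      rw [hR]
      have h3 := abs_nonneg (∑ k, (x k * (x k)ᴴ).trace.re)
      have h4 : (0:ℝ) ≤ n := Nat.cast_nonneg n
      linarith
    | succ m ih =>
      intro v hv
      obtain ⟨w, hw, h⟩ := exists_rowColBall x hv
      have := ih w hw
      rw [pow_succ]
      linarith
  refine le_of_tendsto_of_tendsto' tendsto_const_nhds (b := Filter.atTop)
    (g := fun m : ℕ => 2 * radAvg 1 x + R * (1 / 2) ^ m) ?_ fun m => key m v hv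
  have := (tendsto_pow_atTop_nhds_zero_of_lt_one (r := (1 / 2 : ℝ)) (by norm_num)
    (by norm_num)).const_mul R
  simpa using this.const_add (2 * radAvg 1 x)

end Duality

section Decomposition

variable {ι : Type*} [Fintype ι] {N : ℕ}

theorem exists_rep_pi {κ : Type*} [Fintype κ] (g : (κ → ℂ) →ₗ[ℝ] ℝ) :
    ∃ a : κ → ℂ, ∀ v, g v = ∑ c, (a c * star (v c)).re := by
  classical
  refine ⟨fun c => ⟨g (Pi.single c 1), g (Pi.single c Complex.I)⟩, fun v => ?_⟩
  conv_lhs => rw [← Finset.univ_sum_single v, map_sum]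
  refine Finset.sum_congr rfl fun c _ => ?_
  have : (Pi.single c (v c) : κ → ℂ) =
      (v c).re • (Pi.single c 1 : κ → ℂ) + (v c).im • (Pi.single c Complex.I : κ → ℂ) := by
    rw [← Pi.single_smul, ← Pi.single_smul, ← Pi.single_add]
    congr 1
    apply Complex.ext <;> simp
  rw [this, map_add, map_smul, map_smul]
  simp
  ring

theorem re_trace_mul_conjTranspose_eq {n : Type*} [Fintype n] (a v : Matrix n n ℂ) :
    (a * vᴴ).trace.re = ∑ i, ∑ j, (a i j * star (v i j)).re := by
  simp [trace, mul_apply, Complex.re_sum]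

theorem exists_rep_matrix (g : (Fin N → Matrix ι ι ℂ) →ₗ[ℝ] ℝ) :
    ∃ a : Fin N → Matrix ι ι ℂ, ∀ v, g v = ∑ k, (a k * (v k)ᴴ).trace.re := by
  let T : (Fin N × ι × ι → ℂ) →ₗ[ℝ] (Fin N → Matrix ι ι ℂ) :=
    { toFun := fun u k => of fun i j => u (k, i, j)
      map_add' := fun _ _ => rfl
      map_smul' := fun _ _ => rfl }
  obtain ⟨a, ha⟩ := exists_rep_pi (g ∘ₗ T)
  refine ⟨T a, fun v => ?_⟩
  have := ha fun c => v c.1 c.2.1 c.2.2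
  simp only [re_trace_mul_conjTranspose_eq]
  rw [Fintype.sum_prod_type, Finset.sum_congr rfl fun _ _ => Fintype.sum_prod_type _] at this
  exact this

variable [DecidableEq ι]

open scoped MatrixOrder Matrix.Norms.L2Operator in
/-- The column norm of a finite sequence of matrices. -/
theorem exists_columnSeminorm : ∃ s : Seminorm ℝ (Fin N → Matrix ι ι ℂ),
    ∀ v, s v ≤ 1 ↔ (1 - ∑ k, (v k)ᴴ * v k).PosSemidef := by
  let T : (Fin N → Matrix ι ι ℂ) →ₗ[ℝ] Matrix (Fin N × ι) ι ℂ :=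
    { toFun := fun v => of fun p j => v p.1 p.2 j
      map_add' := fun _ _ => rfl
      map_smul' := fun _ _ => rfl }
  refine ⟨(normSeminorm ℝ (Matrix (Fin N × ι) ι ℂ)).comp T, fun v => ?_⟩
  have h : (T v)ᴴ * T v = ∑ k, (v k)ᴴ * v k := by
    ext i j
    rw [mul_apply, Matrix.sum_apply, Fintype.sum_prod_type]
    rfl
  rw [Seminorm.comp_apply, coe_normSeminorm, ← h, ← le_iff,
    ← CStarAlgebra.norm_le_one_iff_of_nonneg _ (posSemidef_conjTranspose_mul_self (T v)).nonneg,
    l2_opNorm_conjTranspose_mul_self, ← sq, sq_le_one_iff₀ (norm_nonneg _)]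

/-- The pairing `∑ Re Tr (x_k v_k*)` as a linear functional of `v`. -/
noncomputable def rePairing (x : Fin N → Matrix ι ι ℂ) : (Fin N → Matrix ι ι ℂ) →ₗ[ℝ] ℝ where
  toFun v := ∑ k, (x k * (v k)ᴴ).trace.re
  map_add' v w := by
    simp [Matrix.mul_add, trace_add, Finset.sum_add_distrib]
  map_smul' c v := by
    simp [conjTranspose_smul, trace_smul, Finset.mul_sum]

theorem exists_decomposition {Λ : ℝ} (hΛ : 0 ≤ Λ) (x : Fin N → Matrix ι ι ℂ)
    (h : ∀ v, rowColBall v → ∑ k, (x k * (v k)ᴴ).trace.re ≤ Λ) :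
    ∃ a b : Fin N → Matrix ι ι ℂ, (∀ k, x k = a k + b k) ∧
      (∀ v : Fin N → Matrix ι ι ℂ, (1 - ∑ k, (v k)ᴴ * v k).PosSemidef →
        ∑ k, (a k * (v k)ᴴ).trace.re ≤ Λ) ∧
      (∀ v : Fin N → Matrix ι ι ℂ, (1 - ∑ k, v k * (v k)ᴴ).PosSemidef →
        ∑ k, (b k * (v k)ᴴ).trace.re ≤ Λ) := by
  obtain ⟨s, hs⟩ := exists_columnSeminorm (ι := ι) (N := N)
  let J : (Fin N → Matrix ι ι ℂ) →ₗ[ℝ] (Fin N → Matrix ι ι ℂ) :=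
    { toFun := fun v k => (v k)ᴴ
      map_add' := fun v w => by ext1 k; simp
      map_smul' := fun c v => by ext1 k; simp [conjTranspose_smul] }
  set s' := s.comp J with hs'
  have hs1 : ∀ v, s' v ≤ 1 ↔ (1 - ∑ k, v k * (v k)ᴴ).PosSemidef := fun v => by
    rw [hs', Seminorm.comp_apply, hs]
    simp [J]
  let E := Fin N → Matrix ι ι ℂ
  let f : (E × E) →ₗ.[ℝ] ℝ :=
    { domain := LinearMap.eqLocus (LinearMap.fst ℝ E E) (LinearMap.snd ℝ E E)
      toFun := rePairing x ∘ₗ LinearMap.fst ℝ E E ∘ₗ Submodule.subtype _ }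
  obtain ⟨g, hg, hgN⟩ := exists_extension_of_le_sublinear f
    (fun u => Λ * max (s u.1) (s' u.2))
    (fun c hc u => by
      simp only [Prod.smul_fst, Prod.smul_snd, map_smul_eq_mul, Real.norm_of_nonneg hc.le,
        ← mul_max_of_nonneg _ _ hc.le]
      ring)
    (fun u u' => by
      rw [← mul_add]
      refine mul_le_mul_of_nonneg_left (max_le ?_ ?_) hΛ
      · exact (map_add_le_add s _ _).trans (add_le_add (le_max_left _ _) (le_max_left _ _))
      · exact (map_add_le_add s' _ _).trans (add_le_add (le_max_right _ _) (le_max_right _ _)))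
    (fun u => by
      obtain ⟨⟨v, w⟩, hu⟩ := u
      obtain rfl : v = w := hu
      change rePairing x v ≤ Λ * max (s v) (s' v)
      refine le_of_forall_pos_le_add fun δ hδ => ?_
      set r := max (s v) (s' v) + δ / (Λ + 1) with hr
      have hr0 : 0 < r := add_pos_of_nonneg_of_pos ((apply_nonneg s v).trans (le_max_left _ _))
        (by positivity)
      have hle : ∀ t : Seminorm ℝ E, t v ≤ max (s v) (s' v) → t (r⁻¹ • v) ≤ 1 := fun t ht => by
        rw [map_smul_eq_mul, Real.norm_of_nonneg (inv_pos.2 hr0).le, inv_mul_le_one₀ hr0]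
        exact ht.trans (le_add_of_nonneg_right (by positivity))
      have := h (r⁻¹ • v) ⟨(hs _).1 (hle s (le_max_left _ _)), (hs1 _).1 (hle s' (le_max_right _ _))⟩
      change rePairing x (r⁻¹ • v) ≤ Λ at this
      rw [map_smul, smul_eq_mul, inv_mul_le_iff₀ hr0] at this
      refine this.trans ?_
      rw [hr, add_mul, mul_comm Λ]
      have : δ / (Λ + 1) * Λ ≤ δ := by
        rw [div_mul_eq_mul_div, div_le_iff₀ (by positivity)]
        nlinarith
      linarith)
  obtain ⟨a, ha⟩ := exists_rep_matrix (g ∘ₗ LinearMap.inl ℝ E E)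
  obtain ⟨b, hb⟩ := exists_rep_matrix (g ∘ₗ LinearMap.inr ℝ E E)
  refine ⟨a, b, fun k => ?_, fun v hv => ?_, fun v hv => ?_⟩
  · have key : ∀ v, rePairing (x - (a + b)) v = 0 := fun v => by
      have h1 : g (v, v) = rePairing x v := hg ⟨(v, v), rfl⟩
      have h2 : g (v, v) = rePairing a v + rePairing b v := by
        rw [show ((v, v) : E × E) = LinearMap.inl ℝ E E v + LinearMap.inr ℝ E E v by simp, map_add]
        exact congrArg₂ (· + ·) (ha v) (hb v)
      have h3 : rePairing (x - (a + b)) v = rePairing x v - (rePairing a v + rePairing b v) := by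
        simp [rePairing, Matrix.sub_mul, Matrix.add_mul, Finset.sum_add_distrib]
      rw [h3, ← h1, h2, sub_self]
    have h0 : ∀ k, 0 ≤ ((x - (a + b)) k * ((x - (a + b)) k)ᴴ).trace := fun k =>
      (posSemidef_self_mul_conjTranspose _).trace_nonneg
    have hk := (Finset.sum_eq_zero_iff_of_nonneg fun k _ => (Complex.nonneg_iff.1 (h0 k)).1).1
      (show ∑ k, ((x - (a + b)) k * ((x - (a + b)) k)ᴴ).trace.re = 0 from key _) k
      (Finset.mem_univ k)
    exact sub_eq_zero.1 (trace_mul_conjTranspose_self_eq_zero_iff.1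
      (Complex.ext hk (Complex.nonneg_iff.1 (h0 k)).2.symm))
  · rw [← ha]
    refine (hgN _).trans ?_
    refine mul_le_of_le_one_right hΛ (max_le ?_ ?_)
    · exact (hs v).2 hv
    · exact (map_zero s').trans_le zero_le_one
  · rw [← hb]
    refine (hgN _).trans ?_
    refine mul_le_of_le_one_right hΛ (max_le ?_ ?_)
    · exact (map_zero s).trans_le zero_le_one
    · exact (hs1 v).2 hv

end Decomposition

section TraceNorm

variable {ι : Type*} [Fintype ι] [DecidableEq ι] {N : ℕ}

theorem schattenNorm_one_sqrt_le {a : Fin N → Matrix ι ι ℂ} {Λ : ℝ}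
    (h : ∀ v : Fin N → Matrix ι ι ℂ, (1 - ∑ k, (v k)ᴴ * v k).PosSemidef →
      ∑ k, (a k * (v k)ᴴ).trace.re ≤ Λ) :
    schattenNorm 1 (posPow (∑ k, (a k)ᴴ * a k) (1 / 2)) ≤ Λ := by
  have hC : (∑ k, (a k)ᴴ * a k).PosSemidef :=
    posSemidef_sum _ fun k _ => posSemidef_conjTranspose_mul_self _
  obtain ⟨U, d, hU, hCd, hd⟩ := exists_spectralForm_nonneg hC
  set F := spectralForm U fun i => (√(d i))⁻¹ with hF
  have hFH : Fᴴ = F := isHermitian_spectralForm _ _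
  have h1 : (1 - ∑ k, (a k * F)ᴴ * (a k * F)).PosSemidef := by
    have e : ∑ k, (a k * F)ᴴ * (a k * F) = F * (∑ k, (a k)ᴴ * a k) * F := by
      simp only [conjTranspose_mul, hFH, Matrix.mul_sum, Matrix.sum_mul, Matrix.mul_assoc]
    have := posSemidef_spectralForm (U := U) (d := fun i => 1 - (√(d i))⁻¹ * d i * (√(d i))⁻¹)
      fun i => by
        rcases eq_or_lt_of_le' (hd i) with h0 | h0
        · simp [h0]
        · have hs := Real.sqrt_pos.2 h0
          nth_rw 2 [← Real.mul_self_sqrt (hd i)]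
          field_simp
          simp
    convert this using 1
    rw [e, hCd, hF, spectralForm_mul hU, spectralForm_mul hU, sub_eq_iff_eq_add, spectralForm_add,
      ← spectralForm_one hU]
    simp
  refine le_trans (le_of_eq ?_) (h _ h1)
  have e : ∑ k, (a k * (a k * F)ᴴ).trace.re = (F * ∑ k, (a k)ᴴ * a k).trace.re := by
    rw [Matrix.mul_sum, trace_sum, Complex.re_sum]
    refine Finset.sum_congr rfl fun k _ => ?_
    rw [conjTranspose_mul, hFH, trace_mul_comm, Matrix.mul_assoc]
  rw [e, schattenNorm_sqrt hC, hCd, posPow_spectralForm hU, hF, spectralForm_mul hU,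
    trace_spectralForm hU, trace_spectralForm hU, Complex.ofReal_re, Complex.ofReal_re, div_one,
    Real.rpow_one]
  refine Finset.sum_congr rfl fun i _ => ?_
  rw [← Real.sqrt_eq_rpow, inv_mul_eq_div, Real.div_sqrt]

theorem tripleNorm_one_le {n : ℕ} (x : Fin N → Matrix (Fin n) (Fin n) ℂ) :
    tripleNorm 1 x ≤ 4 * radAvg 1 x := by
  obtain ⟨a, b, hx, ha, hb⟩ := exists_decomposition
    (mul_nonneg zero_le_two (radAvg_nonneg 1 x)) x fun v hv => sum_re_trace_le_of_rowColBall x hv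
  have h1 := schattenNorm_one_sqrt_le ha
  have h2 := schattenNorm_one_sqrt_le (a := fun k => (b k)ᴴ) fun v hv => by
    have := hb (fun k => (v k)ᴴ) (by simpa using hv)
    refine le_trans (le_of_eq (Finset.sum_congr rfl fun k _ => ?_)) this
    rw [re_trace_mul_eq, conjTranspose_conjTranspose]
  simp only [conjTranspose_conjTranspose] at h2
  linarith [tripleNorm_le_of_mem 1 hx]

end TraceNorm

/-- Theorem 1.1: extrapolation of the non-commutative Khintchine inequality for `1 ≤ p < q`. -/
theorem statement4 (q p β : ℝ) (hq1 : 1 < q) (hq2 : q < 2) (hp0 : 1 ≤ p) (hp1 : p < q)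
    (hK : ∀ (n N : ℕ) (x : Fin N → Matrix (Fin n) (Fin n) ℂ),
      tripleNorm q x ≤ β * (radAvg q x) ^ (1 / q)) :
    ∃ β' : ℝ, 0 < β' ∧ ∀ (n N : ℕ) (x : Fin N → Matrix (Fin n) (Fin n) ℂ),
      tripleNorm p x ≤ β' * (radAvg p x) ^ (1 / p) := by
  rcases hp0.eq_or_lt with rfl | hp
  · exact ⟨4, by norm_num, fun n N x => by simpa using tripleNorm_one_le x⟩
  · have h : 0 < p - 1 := sub_pos.2 hp
    exact ⟨_, by positivity, fun n N x => tripleNorm_le_of_one_lt hp (hp1.trans hq2) x⟩
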